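/- arXiv:0905.2092 — 2 statements merged into one kernel-verified Lean document; each statement's English description precedes it below -/
import Mathlib

section
/- Assume M ∉ {0, −2, −4, …}. The Pizzetti integral ∫_SS satisfies ∫_SS(H_k H_l) = 0 for all k ≠ l, H_k ∈ ℋ_k, H_l ∈ ℋ_l. Conversely, if T is any integration over the supersphere (i.e. a linear functional T : 𝒫 → ℝ with T(x² f) = −T(f) for all f ∈ 𝒫 and T(f ∘ g) = T(f) for all g ∈ SO(m) × Sp(2n)) satisfying T(H_k H_l) = 0 for all k ≠ l, H_k ∈ ℋ_k, H_l ∈ ℋ_l, then T is a scalar multiple of the Pizzetti integral ∫_SS. -/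
set_option synthInstance.maxHeartbeats 1000000
set_option maxHeartbeats 1000000
open scoped TensorProduct
open MvPolynomial Matrix

noncomputable section

variable (m n : ℕ)

/-- The Grassmann algebra Λ_{2n} on `2n` anticommuting generators. -/
abbrev Grass (n : ℕ) := ExteriorAlgebra ℝ (Fin (2*n) → ℝ)

/-- The algebra of super-polynomials 𝒫 = ℝ[x_1,…,x_m] ⊗ Λ_{2n}. -/
abbrev SuperPoly (m n : ℕ) := MvPolynomial (Fin m) ℝ ⊗[ℝ] Grass n

/-- The fermionic generator x`_i. -/
def fgen (i : Fin (2*n)) : Grass n :=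
  ExteriorAlgebra.ι ℝ (Pi.single i (1:ℝ))

/-- The fermionic partial derivative ∂_{x`_i}, the odd derivation with
∂_{x`_i}(x`_j) = δ_{ij}: contraction with the i-th dual basis vector. -/
def fpderiv (i : Fin (2*n)) : Grass n →ₗ[ℝ] Grass n :=
  CliffordAlgebra.contractLeft (LinearMap.proj i)

/-- The fermionic Laplace operator on Λ_{2n}. -/
def lapF : Grass n →ₗ[ℝ] Grass n :=
  (4:ℝ) • ∑ j : Fin n,
    (fpderiv n ⟨2*j.1, by omega⟩) ∘ₗ (fpderiv n ⟨2*j.1+1, by omega⟩)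

/-- The bosonic Laplace operator Δ_b = −∑ ∂_{x_j}² on ℝ[x_1,…,x_m]. -/
def lapB : MvPolynomial (Fin m) ℝ →ₗ[ℝ] MvPolynomial (Fin m) ℝ :=
  - ∑ j : Fin m, (pderiv j).toLinearMap ∘ₗ (pderiv j).toLinearMap

/-- The super Laplace operator Δ = Δ_b + Δ_f on 𝒫. -/
def lap : SuperPoly m n →ₗ[ℝ] SuperPoly m n :=
  LinearMap.rTensor (Grass n) (lapB m) + LinearMap.lTensor (MvPolynomial (Fin m) ℝ) (lapF n)

/-- x̲² = −∑ x_j². -/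
def rb2 : MvPolynomial (Fin m) ℝ := - ∑ j : Fin m, (X j)^2

/-- x`² = ∑_{j=1}^n x`_{2j−1} x`_{2j}. -/
def rf2 : Grass n := ∑ j : Fin n, fgen n ⟨2*j.1, by omega⟩ * fgen n ⟨2*j.1+1, by omega⟩

/-- The generalized norm squared x² = x̲² + x`² as an element of 𝒫. -/
def r2 : SuperPoly m n := (rb2 m) ⊗ₜ 1 + 1 ⊗ₜ (rf2 n)

/-- The grade-`i` part of the Grassmann algebra. -/
def fgrade (i : ℕ) : Submodule ℝ (Grass n) :=
  (LinearMap.range (ExteriorAlgebra.ι ℝ (M := Fin (2*n) → ℝ)))^i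

/-- The space 𝒫_k of super-polynomials homogeneous of total degree k. -/
def P (k : ℕ) : Submodule ℝ (SuperPoly m n) :=
  ⨆ i : Fin (k+1), Submodule.map₂ (TensorProduct.mk ℝ _ _)
    (homogeneousSubmodule (Fin m) ℝ (k - i.1)) (fgrade n i.1)

/-- The space ℋ_k of spherical harmonics of degree k. -/
def H (k : ℕ) : Submodule ℝ (SuperPoly m n) :=
  P m n k ⊓ LinearMap.ker (lap m n)

/-- The super-dimension M = m − 2n. -/
def sdim : ℤ := (m : ℤ) - 2*n

/-- ℋ^b_p: classical harmonic polynomials of degree p in x_1,…,x_m. -/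
def Hb (p : ℕ) : Submodule ℝ (MvPolynomial (Fin m) ℝ) :=
  homogeneousSubmodule (Fin m) ℝ p ⊓ LinearMap.ker (lapB m)

/-- ℋ^f_q: fermionic (symplectic) harmonics of degree q. -/
def Hf (q : ℕ) : Submodule ℝ (Grass n) :=
  fgrade n q ⊓ LinearMap.ker (lapF n)

/-- ℋ^b_p · ℋ^f_q: the span in 𝒫 of the products H^b H^f. -/
def HbHf (p q : ℕ) : Submodule ℝ (SuperPoly m n) :=
  Submodule.map₂ (TensorProduct.mk ℝ _ _) (Hb m p) (Hf n q)
/-- The polynomial f_{k,p,q} = ∑_{i=0}^k C(k,i)((n−q−i)!/Γ(m/2+p+k−i)) x̲^{2(k−i)} x`^{2i}. -/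
def fkpq (m n k p q : ℕ) : SuperPoly m n :=
  ∑ i ∈ Finset.range (k+1),
    ((Nat.choose k i : ℝ) * ((n - q - i).factorial : ℝ) /
        Real.Gamma ((m:ℝ)/2 + p + k - i)) • (((rb2 m)^(k-i)) ⊗ₜ[ℝ] ((rf2 n)^i))

/-- The 2n × 2n block-diagonal matrix with n diagonal blocks [[0, 1/2], [−1/2, 0]]. -/
def Jmat (n : ℕ) : Matrix (Fin (2*n)) (Fin (2*n)) ℝ := fun i j =>
  if j.1 = i.1 + 1 ∧ i.1 % 2 = 0 then 1/2
  else if i.1 = j.1 + 1 ∧ j.1 % 2 = 0 then -1/2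
  else 0

/-- A ∈ SO(m). -/
def isSO (m : ℕ) (A : Matrix (Fin m) (Fin m) ℝ) : Prop :=
  Aᵀ * A = 1 ∧ A.det = 1

/-- D ∈ Sp(2n). -/
def isSp (n : ℕ) (D : Matrix (Fin (2*n)) (Fin (2*n)) ℝ) : Prop :=
  Dᵀ * Jmat n * D = Jmat n

/-- The action of the pair (A, D) on 𝒫 by algebra automorphisms, via the linear
substitution of variables (x, x`) ↦ (A x, D x`). -/
def act (m n : ℕ) (A : Matrix (Fin m) (Fin m) ℝ) (D : Matrix (Fin (2*n)) (Fin (2*n)) ℝ) :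
    SuperPoly m n →ₐ[ℝ] SuperPoly m n :=
  Algebra.TensorProduct.map
    (aeval (fun j : Fin m => ∑ i : Fin m, A j i • (X i : MvPolynomial (Fin m) ℝ)))
    (ExteriorAlgebra.map (Matrix.toLin' D))

/-- The space of integrations over the supersphere: linear functionals T with
T(x² f) = −T(f) and T(f ∘ g) = T(f) for all g ∈ SO(m) × Sp(2n). -/
def Integrations (m n : ℕ) : Submodule ℝ (SuperPoly m n →ₗ[ℝ] ℝ) where
  carrier := {T | (∀ f, T (r2 m n * f) = - T f) ∧
    (∀ A D, isSO m A → isSp n D → ∀ f, T (act m n A D f) = T f)}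
  add_mem' := by
    rintro T S ⟨hT1, hT2⟩ ⟨hS1, hS2⟩
    refine ⟨fun f => ?_, fun A D hA hD f => ?_⟩
    · simp only [LinearMap.add_apply, hT1 f, hS1 f]; ring
    · simp only [LinearMap.add_apply, hT2 A D hA hD f, hS2 A D hA hD f]
  zero_mem' := by
    refine ⟨fun f => ?_, fun A D hA hD f => ?_⟩ <;> simp
  smul_mem' := by
    rintro c T ⟨hT1, hT2⟩
    refine ⟨fun f => ?_, fun A D hA hD f => ?_⟩
    · simp only [LinearMap.smul_apply, hT1 f, smul_eq_mul]; ring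
    · simp only [LinearMap.smul_apply, hT2 A D hA hD f]

/-- The constant term of a super-polynomial: evaluation at x = x` = 0. -/
def constTerm (m n : ℕ) : SuperPoly m n →ₗ[ℝ] ℝ :=
  (TensorProduct.lid ℝ ℝ).toLinearMap ∘ₗ
    TensorProduct.map (aeval (fun _ : Fin m => (0:ℝ))).toLinearMap
      (ExteriorAlgebra.algebraMapInv).toLinearMap

/-- The Pizzetti integral ∫_SS R = ∑_k (−1)^k (2π^{M/2}/(4^k k! Γ(k+M/2))) (Δ^k R)(0);
the sum has only finitely many nonzero terms for each R. -/
def pizzetti (m n : ℕ) (R : SuperPoly m n) : ℝ :=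
  ∑' k : ℕ, (-1:ℝ)^k *
    (2 * Real.pi ^ ((sdim m n : ℝ)/2) / (4^k * k.factorial * Real.Gamma (k + (sdim m n : ℝ)/2))) *
    constTerm m n (((lap m n)^k) R)

/-! ### The fermionic Laplace operator -/

lemma fpderiv_ι_mul (i : Fin (2 * n)) (v : Fin (2 * n) → ℝ) (w : Grass n) :
    fpderiv n i (ExteriorAlgebra.ι ℝ v * w) = v i • w - ExteriorAlgebra.ι ℝ v * fpderiv n i w :=
  CliffordAlgebra.contractLeft_ι_mul ..

lemma fpderiv_algebraMap (i : Fin (2 * n)) (r : ℝ) :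
    fpderiv n i (algebraMap ℝ (Grass n) r) = 0 :=
  CliffordAlgebra.contractLeft_algebraMap ..

lemma fpderiv_comm (i j : Fin (2 * n)) (w : Grass n) :
    fpderiv n i (fpderiv n j w) = -fpderiv n j (fpderiv n i w) :=
  CliffordAlgebra.contractLeft_comm ..

lemma lapF_apply (w : Grass n) :
    lapF n w = (4 : ℝ) • ∑ j : Fin n,
      fpderiv n ⟨2 * j.1, by omega⟩ (fpderiv n ⟨2 * j.1 + 1, by omega⟩ w) := by
  simp [lapF]

lemma lapF_fpderiv (i : Fin (2 * n)) (w : Grass n) :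
    lapF n (fpderiv n i w) = fpderiv n i (lapF n w) := by
  simp only [lapF_apply, map_smul, map_sum]
  congr 1
  refine Finset.sum_congr rfl fun j _ => ?_
  rw [fpderiv_comm n _ i w, map_neg, fpderiv_comm n _ i, neg_neg]

/-- The first-order operator `[Δ_f, v]` for a fermionic linear form `v`. -/
def lapFComm (v : Fin (2 * n) → ℝ) : Grass n →ₗ[ℝ] Grass n :=
  (4 : ℝ) • ∑ j : Fin n, (v ⟨2 * j.1 + 1, by omega⟩ • fpderiv n ⟨2 * j.1, by omega⟩
    - v ⟨2 * j.1, by omega⟩ • fpderiv n ⟨2 * j.1 + 1, by omega⟩)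

lemma lapF_ι_mul (v : Fin (2 * n) → ℝ) (w : Grass n) :
    lapF n (ExteriorAlgebra.ι ℝ v * w) = ExteriorAlgebra.ι ℝ v * lapF n w + lapFComm n v w := by
  simp only [lapF_apply, lapFComm, LinearMap.smul_apply, LinearMap.sum_apply, LinearMap.sub_apply,
    mul_smul_comm, ← smul_add, Finset.mul_sum, ← Finset.sum_add_distrib]
  congr 1
  refine Finset.sum_congr rfl fun j _ => ?_
  simp only [fpderiv_ι_mul, map_sub, map_smul]
  abel

lemma lapF_lapFComm (v : Fin (2 * n) → ℝ) (w : Grass n) :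
    lapF n (lapFComm n v w) = lapFComm n v (lapF n w) := by
  simp [lapFComm, lapF_fpderiv]

/-- The fermionic Euler operator. -/
def eulerF : Grass n →ₗ[ℝ] Grass n :=
  ∑ j : Fin n,
    (LinearMap.mulLeft ℝ (fgen n ⟨2 * j.1, by omega⟩) ∘ₗ fpderiv n ⟨2 * j.1, by omega⟩ +
     LinearMap.mulLeft ℝ (fgen n ⟨2 * j.1 + 1, by omega⟩) ∘ₗ fpderiv n ⟨2 * j.1 + 1, by omega⟩)

lemma eulerF_apply (w : Grass n) :
    eulerF n w = ∑ j : Fin n,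
      (fgen n ⟨2 * j.1, by omega⟩ * fpderiv n ⟨2 * j.1, by omega⟩ w +
       fgen n ⟨2 * j.1 + 1, by omega⟩ * fpderiv n ⟨2 * j.1 + 1, by omega⟩ w) := by
  simp [eulerF]

lemma sum_fin_two_mul {A : Type*} [AddCommMonoid A] (f : Fin (2 * n) → A) :
    ∑ i, f i = ∑ j : Fin n, (f ⟨2 * j.1, by omega⟩ + f ⟨2 * j.1 + 1, by omega⟩) := by
  rw [← (finProdFinEquiv.trans (finCongr (mul_comm n 2))).sum_comp, Fintype.sum_prod_type]
  refine Finset.sum_congr rfl fun j _ => ?_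
  rw [Fin.sum_univ_two]
  congr 2 <;> ext <;> simp [finProdFinEquiv, add_comm]

lemma ι_eq_sum_fgen (v : Fin (2 * n) → ℝ) :
    ExteriorAlgebra.ι ℝ v = ∑ j : Fin n,
      (v ⟨2 * j.1, by omega⟩ • fgen n ⟨2 * j.1, by omega⟩ +
       v ⟨2 * j.1 + 1, by omega⟩ • fgen n ⟨2 * j.1 + 1, by omega⟩) := by
  rw [← sum_fin_two_mul n fun i => v i • fgen n i]
  conv_lhs => rw [pi_eq_sum_univ' v]
  simp only [map_sum, map_smul, fgen]

lemma ι_mul_ι_comm (v u : Fin (2 * n) → ℝ) (w : Grass n) :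
    ExteriorAlgebra.ι ℝ v * (ExteriorAlgebra.ι ℝ u * w) =
      -(ExteriorAlgebra.ι ℝ u * (ExteriorAlgebra.ι ℝ v * w)) := by
  rw [← mul_assoc, ← mul_assoc, eq_neg_iff_add_eq_zero, ← add_mul,
    ExteriorAlgebra.ι_add_mul_swap, zero_mul]

lemma eulerF_ι_mul (v : Fin (2 * n) → ℝ) (w : Grass n) :
    eulerF n (ExteriorAlgebra.ι ℝ v * w) =
      ExteriorAlgebra.ι ℝ v * w + ExteriorAlgebra.ι ℝ v * eulerF n w := by
  conv_rhs => enter [1]; rw [ι_eq_sum_fgen]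
  rw [eulerF_apply, eulerF_apply, Finset.sum_mul, Finset.mul_sum, ← Finset.sum_add_distrib]
  refine Finset.sum_congr rfl fun j _ => ?_
  simp only [fpderiv_ι_mul, mul_sub, add_mul, mul_add, mul_smul_comm, smul_mul_assoc, fgen,
    ι_mul_ι_comm n _ v]
  abel

lemma eulerF_of_mem_fgrade {b : ℕ} {w : Grass n} (hw : w ∈ fgrade n b) :
    eulerF n w = (b : ℝ) • w := by
  induction hw using Submodule.pow_induction_on_left' with
  | algebraMap r => simp [eulerF_apply, fpderiv_algebraMap]
  | add x y i _ _ hx hy => rw [map_add, hx, hy, smul_add]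
  | mem_mul u hu i x _ ih =>
    obtain ⟨v, rfl⟩ := hu
    rw [eulerF_ι_mul, ih, mul_smul_comm, Nat.cast_succ, add_smul, one_smul, add_comm]

lemma lapFComm_single_even (k : Fin n) :
    lapFComm n (Pi.single ⟨2 * k.1, by omega⟩ 1) =
      -((4 : ℝ) • fpderiv n ⟨2 * k.1 + 1, by omega⟩) := by
  rw [lapFComm, Finset.sum_eq_single k]
  · simp
  · intro j _ hj
    have h1 : 2 * j.1 + 1 ≠ 2 * k.1 := by omega
    have h2 : j.1 ≠ k.1 := fun h => hj (Fin.ext h)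
    simp [h1, h2]
  · simp

lemma lapFComm_single_odd (k : Fin n) :
    lapFComm n (Pi.single ⟨2 * k.1 + 1, by omega⟩ 1) =
      (4 : ℝ) • fpderiv n ⟨2 * k.1, by omega⟩ := by
  rw [lapFComm, Finset.sum_eq_single k]
  · simp
  · intro j _ hj
    have h1 : 2 * j.1 ≠ 2 * k.1 + 1 := by omega
    have h2 : j.1 ≠ k.1 := fun h => hj (Fin.ext h)
    simp [h1, h2]
  · simp

lemma lapF_rf2_mul {b : ℕ} {w : Grass n} (hw : w ∈ fgrade n b) :
    lapF n (rf2 n * w) = rf2 n * lapF n w + (4 * (b : ℝ) - 4 * n) • w := by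
  have key : ∀ k : Fin n,
      lapF n (fgen n ⟨2 * k.1, by omega⟩ * fgen n ⟨2 * k.1 + 1, by omega⟩ * w) =
      fgen n ⟨2 * k.1, by omega⟩ * fgen n ⟨2 * k.1 + 1, by omega⟩ * lapF n w +
      ((4 : ℝ) • (fgen n ⟨2 * k.1, by omega⟩ * fpderiv n ⟨2 * k.1, by omega⟩ w +
       fgen n ⟨2 * k.1 + 1, by omega⟩ * fpderiv n ⟨2 * k.1 + 1, by omega⟩ w) - (4 : ℝ) • w) := by
    intro k
    simp only [fgen, mul_assoc, lapF_ι_mul, lapFComm_single_even, lapFComm_single_odd,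
      LinearMap.neg_apply, LinearMap.smul_apply, fpderiv_ι_mul, mul_add, mul_smul_comm,
      Pi.single_eq_same, one_smul, smul_sub, smul_add]
    abel
  rw [rf2, Finset.sum_mul, map_sum, Finset.sum_congr rfl fun k _ => key k,
    Finset.sum_add_distrib, Finset.sum_sub_distrib, ← Finset.smul_sum, ← eulerF_apply,
    eulerF_of_mem_fgrade n hw, ← Finset.sum_mul, Finset.sum_const, Finset.card_univ,
    Fintype.card_fin, smul_smul, ← Nat.cast_smul_eq_nsmul ℝ, smul_smul, sub_smul, mul_comm (n : ℝ)]

lemma fpderiv_of_mem_fgrade_zero (i : Fin (2 * n)) {w : Grass n} (hw : w ∈ fgrade n 0) :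
    fpderiv n i w = 0 := by
  rw [fgrade, pow_zero, Submodule.mem_one] at hw
  obtain ⟨r, rfl⟩ := hw
  exact fpderiv_algebraMap n i r

lemma fpderiv_mem_fgrade (i : Fin (2 * n)) {b : ℕ} {w : Grass n} (hw : w ∈ fgrade n b) :
    fpderiv n i w ∈ fgrade n (b - 1) := by
  induction hw using Submodule.pow_induction_on_left' with
  | algebraMap r => rw [fpderiv_algebraMap]; exact zero_mem _
  | add x y i _ _ hx hy => rw [map_add]; exact add_mem hx hy
  | mem_mul u hu b x hx ih =>
    obtain ⟨v, rfl⟩ := hu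
    rw [fpderiv_ι_mul]
    refine sub_mem (Submodule.smul_mem _ _ hx) ?_
    cases b with
    | zero => rw [fpderiv_of_mem_fgrade_zero n i hx, mul_zero]; exact zero_mem _
    | succ b =>
      change _ ∈ _ ^ (b + 1)
      rw [pow_succ']
      exact Submodule.mul_mem_mul (LinearMap.mem_range_self _ v) ih

lemma lapF_mem_fgrade {b : ℕ} {w : Grass n} (hw : w ∈ fgrade n (b + 2)) :
    lapF n w ∈ fgrade n b := by
  rw [lapF_apply]
  exact Submodule.smul_mem _ _ (sum_mem fun j _ =>
    fpderiv_mem_fgrade n _ (fpderiv_mem_fgrade n _ hw))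

lemma lapF_of_mem_fgrade_lt_two {b : ℕ} (hb : b < 2) {w : Grass n} (hw : w ∈ fgrade n b) :
    lapF n w = 0 := by
  rw [lapF_apply, Finset.sum_eq_zero, smul_zero]
  intro j _
  apply fpderiv_of_mem_fgrade_zero
  have := fpderiv_mem_fgrade n ⟨2 * j.1 + 1, by omega⟩ hw
  rwa [show b - 1 = 0 by omega] at this

lemma fpderiv_involute (i : Fin (2 * n)) (w : Grass n) :
    fpderiv n i (CliffordAlgebra.involute w) = -CliffordAlgebra.involute (fpderiv n i w) := by
  induction w using CliffordAlgebra.left_induction with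
  | algebraMap r =>
    have := fpderiv_algebraMap n i r
    rw [AlgHom.commutes, this, map_zero, neg_zero]
  | add x y hx hy => rw [map_add, map_add, map_add, map_add, hx, hy, neg_add]
  | ι_mul x v ih =>
    have h1 := fpderiv_ι_mul n i v (CliffordAlgebra.involute x)
    have h2 := fpderiv_ι_mul n i v x
    rw [map_mul, CliffordAlgebra.involute_ι, neg_mul, map_neg, h1, h2, map_sub, map_mul,
      CliffordAlgebra.involute_ι, map_smul, ih]
    simp

lemma lapF_involute (w : Grass n) :
    lapF n (CliffordAlgebra.involute w) = CliffordAlgebra.involute (lapF n w) := by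
  simp [lapF_apply, fpderiv_involute]

lemma mul_ι_eq (w : Grass n) (v : Fin (2 * n) → ℝ) :
    w * ExteriorAlgebra.ι ℝ v = ExteriorAlgebra.ι ℝ v * CliffordAlgebra.involute w := by
  induction w using CliffordAlgebra.left_induction with
  | algebraMap r => rw [AlgHom.commutes, Algebra.commutes]
  | add x y hx hy => rw [add_mul, map_add, mul_add, hx, hy]
  | ι_mul x u ih =>
    rw [mul_assoc, ih, map_mul, CliffordAlgebra.involute_ι, neg_mul, mul_neg]
    exact ι_mul_ι_comm n u v _

/-! ### Operators nilpotent under commutation -/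

section AdNil

variable {R : Type*} [Ring R]

/-- `a` is annihilated by the `(k + 1)`-st power of the commutator `[d, ·]`. -/
def AdNil (d : R) : ℕ → R → Prop
  | 0, a => d * a = a * d
  | k + 1, a => AdNil d k (d * a - a * d)

lemma AdNil.zero (d : R) (k : ℕ) : AdNil d k 0 := by
  induction k with
  | zero => simp [AdNil]
  | succ k ih => simpa [AdNil] using ih

lemma AdNil.add {d : R} {k : ℕ} {a b : R} (ha : AdNil d k a) (hb : AdNil d k b) :
    AdNil d k (a + b) := by
  induction k generalizing a b with
  | zero =>
    simp only [AdNil] at *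
    rw [mul_add, add_mul, ha, hb]
  | succ k ih =>
    have := ih ha hb
    rw [AdNil]
    convert this using 1
    noncomm_ring

lemma AdNil.sum {ι : Type*} {d : R} {k : ℕ} (s : Finset ι) {f : ι → R}
    (h : ∀ i ∈ s, AdNil d k (f i)) : AdNil d k (∑ i ∈ s, f i) :=
  Finset.sum_induction f (AdNil d k) (fun _ _ => AdNil.add) (AdNil.zero d k) h

lemma AdNil.mul {d : R} {j k : ℕ} {a b : R} (ha : AdNil d j a) (hb : AdNil d k b) :
    AdNil d (j + k) (a * b) := by
  induction j generalizing k a b with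
  | zero =>
    rw [zero_add]
    have ha' : d * a = a * d := ha
    induction k generalizing b with
    | zero =>
      have hb' : d * b = b * d := hb
      change d * (a * b) = a * b * d
      rw [← mul_assoc, ha', mul_assoc, hb', mul_assoc]
    | succ k ih =>
      have := ih hb
      change AdNil d k _
      rwa [← mul_assoc, ha', mul_assoc a b d, mul_assoc a d b, ← mul_sub]
  | succ j ihj =>
    rw [add_right_comm]
    change AdNil d (j + k) _
    have e : d * (a * b) - a * b * d = (d * a - a * d) * b + a * (d * b - b * d) := by
      noncomm_ring
    rw [e]
    refine (ihj ha hb).add ?_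
    clear e
    induction k generalizing b with
    | zero =>
      have hb' : d * b = b * d := hb
      rw [hb', sub_self, mul_zero]
      exact AdNil.zero d _
    | succ k ihk =>
      have hb' : AdNil d k (d * b - b * d) := hb
      change AdNil d (j + k) _
      have e : d * (a * (d * b - b * d)) - a * (d * b - b * d) * d =
          (d * a - a * d) * (d * b - b * d) +
            a * (d * (d * b - b * d) - (d * b - b * d) * d) := by
        noncomm_ring
      rw [e]
      exact (ihj ha hb').add (ihk hb')

lemma AdNil.pow_apply_eq_zero {V : Type*} [AddCommGroup V] [Module ℝ V]
    {d a : Module.End ℝ V} {k s : ℕ} (ha : AdNil d k a) (hs : k < s) {g : V} (hg : d g = 0) :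
    (d ^ s) (a g) = 0 := by
  have key : (d ^ (k + 1)) (a g) = 0 := by
    clear hs
    induction k generalizing a with
    | zero =>
      have ha' : d * a = a * d := ha
      rw [zero_add, pow_one, ← Module.End.mul_apply, ha', Module.End.mul_apply, hg, map_zero]
    | succ k ih =>
      have := ih (a := d * a - a * d) ha
      rw [pow_succ, Module.End.mul_apply]
      simpa [hg] using this
  obtain ⟨t, rfl⟩ : ∃ t, s = t + (k + 1) := ⟨s - (k + 1), by omega⟩
  rw [pow_add, Module.End.mul_apply, key, map_zero]

lemma AdNil.of_intertwine {S : Type*} [Ring S] {d : R} {d' : S} (φ : R → S)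
    (h : ∀ a, d' * φ a - φ a * d' = φ (d * a - a * d)) (h0 : φ 0 = 0) {k : ℕ} {a : R}
    (ha : AdNil d k a) : AdNil d' k (φ a) := by
  induction k generalizing a with
  | zero =>
    have ha' : d * a = a * d := ha
    have := h a
    rw [ha', sub_self, h0, sub_eq_zero] at this
    exact this
  | succ k ih =>
    change AdNil d' k _
    rw [h]
    exact ih ha

end AdNil

/-! ### Multiplication operators are nilpotent under commutation with the Laplace operator -/

lemma lapB_X_mul (i : Fin m) (p : MvPolynomial (Fin m) ℝ) :
    lapB m (X i * p) = X i * lapB m p - (2 : ℝ) • pderiv i p := by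
  have key : ∀ j : Fin m, pderiv j (pderiv j (X i * p)) =
      X i * pderiv j (pderiv j p) + if i = j then (2 : ℝ) • pderiv j p else 0 := by
    intro j
    by_cases h : i = j
    · subst h
      simp only [Derivation.leibniz, pderiv_X_self, map_add, smul_eq_mul, mul_one, if_true, two_smul]
      ring
    · simp [Derivation.leibniz, pderiv_X_of_ne h, h]
  simp only [lapB, LinearMap.neg_apply, LinearMap.sum_apply, LinearMap.comp_apply,
    Derivation.coeFn_coe, key, Finset.sum_add_distrib,
    Finset.sum_ite_eq, Finset.mem_univ, if_true, mul_neg, Finset.mul_sum]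
  abel

lemma pderiv_pderiv_comm {σ : Type*} (i j : σ) (p : MvPolynomial σ ℝ) :
    pderiv i (pderiv j p) = pderiv j (pderiv i p) := by
  classical
  have h : ⁅pderiv (R := ℝ) i, pderiv (R := ℝ) j⁆ = 0 := by
    refine MvPolynomial.derivation_ext fun k => ?_
    rw [Derivation.commutator_apply, pderiv_X, pderiv_X]
    simp only [Pi.single_apply]
    split_ifs <;> simp
  have := DFunLike.congr_fun h p
  rwa [Derivation.commutator_apply, Derivation.zero_apply, sub_eq_zero] at this

lemma lapB_pderiv (i : Fin m) (p : MvPolynomial (Fin m) ℝ) :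
    lapB m (pderiv i p) = pderiv i (lapB m p) := by
  simp only [lapB, LinearMap.neg_apply, LinearMap.sum_apply, LinearMap.comp_apply,
    Derivation.coeFn_coe, map_neg, map_sum]
  congr 1
  refine Finset.sum_congr rfl fun j _ => ?_
  rw [pderiv_pderiv_comm j i, pderiv_pderiv_comm j i]

lemma adNil_mulLeft_X (i : Fin m) :
    AdNil (R := Module.End ℝ (MvPolynomial (Fin m) ℝ)) (lapB m) 1 (LinearMap.mulLeft ℝ (X i)) := by
  have e : (lapB m : Module.End ℝ _) * LinearMap.mulLeft ℝ (X i)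
      - LinearMap.mulLeft ℝ (X i) * (lapB m : Module.End ℝ _)
      = (-2 : ℝ) • (pderiv i).toLinearMap := by
    ext1 p
    ext1
    simp [lapB_X_mul]
  rw [AdNil, e]
  change (_ : Module.End ℝ _) = _
  refine LinearMap.ext fun p => ?_
  simp [lapB_pderiv]

lemma adNil_mulLeft_monomial (d : Fin m →₀ ℕ) :
    AdNil (R := Module.End ℝ (MvPolynomial (Fin m) ℝ)) (lapB m) d.degree
      (LinearMap.mulLeft ℝ (monomial d 1)) := by
  have h1 : AdNil (R := Module.End ℝ (MvPolynomial (Fin m) ℝ)) (lapB m) 0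
      (LinearMap.mulLeft ℝ 1) := by
    rw [LinearMap.mulLeft_one]
    exact (mul_one _).trans (one_mul _).symm
  induction d using Finsupp.induction_linear with
  | zero => simpa using h1
  | add d e hd he =>
    have := hd.mul he
    rw [map_add, ← one_mul (1 : ℝ), ← monomial_mul, LinearMap.mulLeft_mul]
    exact this
  | single i k =>
    rw [Finsupp.degree_single, ← X_pow_eq_monomial]
    induction k with
    | zero => simpa using h1
    | succ k ih =>
      rw [pow_succ, LinearMap.mulLeft_mul]
      exact ih.mul (adNil_mulLeft_X m i)

lemma adNil_mulLeft_of_isHomogeneous {a : ℕ} {p : MvPolynomial (Fin m) ℝ}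
    (hp : p.IsHomogeneous a) :
    AdNil (R := Module.End ℝ (MvPolynomial (Fin m) ℝ)) (lapB m) a (LinearMap.mulLeft ℝ p) := by
  have e : LinearMap.mulLeft ℝ p = ∑ d ∈ p.support,
      (coeff d p • (1 : Module.End ℝ (MvPolynomial (Fin m) ℝ))) *
        LinearMap.mulLeft ℝ (monomial d 1) := by
    refine LinearMap.ext fun q => ?_
    conv_lhs => rw [p.as_sum]
    rw [LinearMap.mulLeft_apply, Finset.sum_mul]
    simp [← smul_mul_assoc, smul_monomial]
  rw [e]
  refine AdNil.sum _ fun d hd => ?_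
  have h0 : AdNil (R := Module.End ℝ (MvPolynomial (Fin m) ℝ)) (lapB m) 0 (coeff d p • 1) := by
    simp [AdNil]
  have hda : d.degree = a := by
    rw [Finsupp.degree_eq_weight_one]
    exact hp (mem_support_iff.1 hd)
  have := h0.mul (adNil_mulLeft_monomial m d)
  rwa [zero_add, hda] at this

lemma adNil_mulLeft_ι (v : Fin (2 * n) → ℝ) :
    AdNil (R := Module.End ℝ (Grass n)) (lapF n) 1
      (LinearMap.mulLeft ℝ (ExteriorAlgebra.ι ℝ v)) := by
  have e : (lapF n : Module.End ℝ _) * LinearMap.mulLeft ℝ (ExteriorAlgebra.ι ℝ v)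
      - LinearMap.mulLeft ℝ (ExteriorAlgebra.ι ℝ v) * (lapF n : Module.End ℝ _)
      = lapFComm n v := by
    refine LinearMap.ext fun w => ?_
    simp [lapF_ι_mul]
  rw [AdNil, e]
  exact LinearMap.ext fun w => lapF_lapFComm n v w

lemma adNil_mulRight_ι (v : Fin (2 * n) → ℝ) :
    AdNil (R := Module.End ℝ (Grass n)) (lapF n) 1
      (LinearMap.mulRight ℝ (ExteriorAlgebra.ι ℝ v)) := by
  have e : LinearMap.mulRight ℝ (ExteriorAlgebra.ι ℝ v) =
      LinearMap.mulLeft ℝ (ExteriorAlgebra.ι ℝ v) *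
        (CliffordAlgebra.involute.toLinearMap : Module.End ℝ (Grass n)) :=
    LinearMap.ext fun w => mul_ι_eq n w v
  have h0 : AdNil (R := Module.End ℝ (Grass n)) (lapF n) 0
      CliffordAlgebra.involute.toLinearMap :=
    LinearMap.ext fun w => lapF_involute n w
  rw [e]
  exact (adNil_mulLeft_ι n v).mul h0

lemma adNil_mul_of_mem_fgrade {b : ℕ} {w : Grass n} (hw : w ∈ fgrade n b) :
    AdNil (R := Module.End ℝ (Grass n)) (lapF n) b (LinearMap.mulLeft ℝ w) ∧
    AdNil (R := Module.End ℝ (Grass n)) (lapF n) b (LinearMap.mulRight ℝ w) := by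
  induction hw using Submodule.pow_induction_on_left' with
  | algebraMap r =>
    have h0 : AdNil (R := Module.End ℝ (Grass n)) (lapF n) 0 (r • 1) := by simp [AdNil]
    constructor
    · convert h0 using 1
      exact LinearMap.ext fun w => (Algebra.smul_def r w).symm
    · convert h0 using 1
      exact LinearMap.ext fun w => by
        rw [LinearMap.mulRight_apply, ← Algebra.commutes, ← Algebra.smul_def]; rfl
  | add x y i _ _ hx hy =>
    constructor
    · convert hx.1.add hy.1 using 1
      exact LinearMap.ext fun w => add_mul x y w
    · convert hx.2.add hy.2 using 1
      exact LinearMap.ext fun w => mul_add w x y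
  | mem_mul u hu i x _ ih =>
    obtain ⟨v, rfl⟩ := hu
    constructor
    · rw [LinearMap.mulLeft_mul, Nat.succ_eq_one_add]
      exact (adNil_mulLeft_ι n v).mul ih.1
    · rw [LinearMap.mulRight_mul]
      exact ih.2.mul (adNil_mulRight_ι n v)

lemma AdNil.rTensor {k : ℕ} {a : Module.End ℝ (MvPolynomial (Fin m) ℝ)}
    (ha : AdNil (R := Module.End ℝ (MvPolynomial (Fin m) ℝ)) (lapB m) k a) :
    AdNil (R := Module.End ℝ (SuperPoly m n)) (lap m n) k (LinearMap.rTensor (Grass n) a) := by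
  refine AdNil.of_intertwine (d := (lapB m : Module.End ℝ (MvPolynomial (Fin m) ℝ)))
    (d' := (lap m n : Module.End ℝ (SuperPoly m n)))
    (LinearMap.rTensorHom (M := Grass n)) (fun a => ?_) (LinearMap.map_zero _) ha
  apply TensorProduct.ext'
  intro p w
  simp only [LinearMap.sub_apply, Module.End.mul_apply, lap, LinearMap.add_apply,
    LinearMap.coe_rTensorHom, LinearMap.rTensor_tmul, LinearMap.lTensor_tmul, map_add,
    TensorProduct.sub_tmul]
  abel

lemma AdNil.lTensor {k : ℕ} {a : Module.End ℝ (Grass n)}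
    (ha : AdNil (R := Module.End ℝ (Grass n)) (lapF n) k a) :
    AdNil (R := Module.End ℝ (SuperPoly m n)) (lap m n) k
      (LinearMap.lTensor (MvPolynomial (Fin m) ℝ) a) := by
  refine AdNil.of_intertwine (d := (lapF n : Module.End ℝ (Grass n)))
    (d' := (lap m n : Module.End ℝ (SuperPoly m n)))
    (LinearMap.lTensorHom (M := MvPolynomial (Fin m) ℝ)) (fun a => ?_) (LinearMap.map_zero _) ha
  apply TensorProduct.ext'
  intro p w
  simp only [LinearMap.sub_apply, Module.End.mul_apply, lap, LinearMap.add_apply,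
    LinearMap.coe_lTensorHom, LinearMap.rTensor_tmul, LinearMap.lTensor_tmul, map_add,
    TensorProduct.tmul_sub]
  abel

lemma P_le_iff {k : ℕ} {S : Submodule ℝ (SuperPoly m n)} :
    P m n k ≤ S ↔ ∀ a b, a + b = k → ∀ p : MvPolynomial (Fin m) ℝ, p.IsHomogeneous a →
      ∀ w ∈ fgrade n b, p ⊗ₜ w ∈ S := by
  rw [P, iSup_le_iff]
  constructor
  · intro h a b hab p hp w hw
    refine Submodule.map₂_le.1 (h ⟨b, by omega⟩) p ?_ w hw
    rw [mem_homogeneousSubmodule]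
    convert hp using 1
    dsimp only
    omega
  · intro h i
    exact Submodule.map₂_le.2 fun p hp w hw => h (k - i.1) i.1 (by omega) p
      ((mem_homogeneousSubmodule _ _).1 hp) w hw

lemma tmul_mem_P {a b : ℕ} {p : MvPolynomial (Fin m) ℝ} (hp : p.IsHomogeneous a)
    {w : Grass n} (hw : w ∈ fgrade n b) : p ⊗ₜ w ∈ P m n (a + b) :=
  (P_le_iff m n).1 le_rfl a b rfl p hp w hw

lemma adNil_mul_of_mem_P {k : ℕ} {f : SuperPoly m n} (hf : f ∈ P m n k) :
    AdNil (R := Module.End ℝ (SuperPoly m n)) (lap m n) k (LinearMap.mulLeft ℝ f) ∧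
    AdNil (R := Module.End ℝ (SuperPoly m n)) (lap m n) k (LinearMap.mulRight ℝ f) := by
  let S : Submodule ℝ (SuperPoly m n) :=
    { carrier := {f |
        AdNil (R := Module.End ℝ (SuperPoly m n)) (lap m n) k (LinearMap.mulLeft ℝ f) ∧
        AdNil (R := Module.End ℝ (SuperPoly m n)) (lap m n) k (LinearMap.mulRight ℝ f)}
      add_mem' := by
        intro f g hf hg
        constructor
        · convert hf.1.add hg.1 using 1
          exact LinearMap.ext fun w => add_mul f g w
        · convert hf.2.add hg.2 using 1
          exact LinearMap.ext fun w => mul_add w f g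
      zero_mem' := by
        simp only [Set.mem_ofPred_eq, LinearMap.mulLeft_zero_eq_zero,
          LinearMap.mulRight_zero_eq_zero]
        exact ⟨AdNil.zero _ k, AdNil.zero _ k⟩
      smul_mem' := by
        intro r f hf
        have h0 : AdNil (R := Module.End ℝ (SuperPoly m n)) (lap m n) 0
            (r • (1 : Module.End ℝ (SuperPoly m n))) :=
          LinearMap.ext fun g => LinearMap.map_smul (lap m n) r g
        constructor
        · convert h0.mul hf.1 using 1
          · rw [zero_add]
          · exact LinearMap.ext fun w => smul_mul_assoc r f w
        · convert h0.mul hf.2 using 1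
          · rw [zero_add]
          · exact LinearMap.ext fun w => mul_smul_comm r w f }
  refine (P_le_iff m n (S := S)).2 ?_ hf
  rintro a b rfl p hp w hw
  have hp' := (adNil_mulLeft_of_isHomogeneous m hp).rTensor m n
  constructor
  · convert hp'.mul ((adNil_mul_of_mem_fgrade n hw).1.lTensor m n) using 1
    apply TensorProduct.ext'
    intro q u
    simp [Module.End.mul_apply]
  · convert hp'.mul ((adNil_mul_of_mem_fgrade n hw).2.lTensor m n) using 1
    apply TensorProduct.ext'
    intro q u
    simp [Module.End.mul_apply, mul_comm q p]

/-! ### The grading -/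

lemma lap_tmul (p : MvPolynomial (Fin m) ℝ) (w : Grass n) :
    lap m n (p ⊗ₜ w) = lapB m p ⊗ₜ w + p ⊗ₜ lapF n w := by
  simp [lap]

lemma lapB_apply (p : MvPolynomial (Fin m) ℝ) :
    lapB m p = -∑ j, pderiv j (pderiv j p) := by
  simp [lapB]

lemma lapB_isHomogeneous {a : ℕ} {p : MvPolynomial (Fin m) ℝ} (hp : p.IsHomogeneous (a + 2)) :
    (lapB m p).IsHomogeneous a := by
  rw [lapB_apply, ← mem_homogeneousSubmodule]
  exact neg_mem (sum_mem fun j _ => (mem_homogeneousSubmodule _ _).2 hp.pderiv.pderiv)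

lemma lapB_of_isHomogeneous_lt_two {a : ℕ} (ha : a < 2) {p : MvPolynomial (Fin m) ℝ}
    (hp : p.IsHomogeneous a) : lapB m p = 0 := by
  rw [lapB_apply, Finset.sum_eq_zero, neg_zero]
  intro j _
  have h : (pderiv j p).IsHomogeneous 0 := by
    convert hp.pderiv (i := j) using 1
    omega
  rw [← totalDegree_zero_iff_isHomogeneous] at h
  rw [totalDegree_eq_zero_iff_eq_C.1 h, pderiv_C]

lemma lap_mem_P {k : ℕ} {f : SuperPoly m n} (hf : f ∈ P m n (k + 2)) : lap m n f ∈ P m n k := by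
  refine (P_le_iff m n (S := (P m n k).comap (lap m n))).2 ?_ hf
  intro a b hab p hp w hw
  rw [Submodule.mem_comap, lap_tmul]
  refine add_mem ?_ ?_
  · obtain ha | ⟨a, rfl⟩ : a < 2 ∨ ∃ c, a = c + 2 := by
      by_cases h : a < 2
      · exact Or.inl h
      · exact Or.inr ⟨a - 2, by omega⟩
    · rw [lapB_of_isHomogeneous_lt_two m ha hp, TensorProduct.zero_tmul]
      exact zero_mem _
    · obtain rfl : a + b = k := by omega
      exact tmul_mem_P m n (lapB_isHomogeneous m hp) hw
  · obtain hb | ⟨b, rfl⟩ : b < 2 ∨ ∃ c, b = c + 2 := by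
      by_cases h : b < 2
      · exact Or.inl h
      · exact Or.inr ⟨b - 2, by omega⟩
    · rw [lapF_of_mem_fgrade_lt_two n hb hw, TensorProduct.tmul_zero]
      exact zero_mem _
    · obtain rfl : a + b = k := by omega
      exact tmul_mem_P m n hp (lapF_mem_fgrade n hw)

lemma lap_eq_zero_of_mem_P {k : ℕ} (hk : k < 2) {f : SuperPoly m n} (hf : f ∈ P m n k) :
    lap m n f = 0 := by
  refine (P_le_iff m n (S := LinearMap.ker (lap m n))).2 ?_ hf
  intro a b hab p hp w hw
  rw [LinearMap.mem_ker, lap_tmul, lapB_of_isHomogeneous_lt_two m (by omega) hp,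
    lapF_of_mem_fgrade_lt_two n (by omega) hw, TensorProduct.zero_tmul, TensorProduct.tmul_zero,
    add_zero]

lemma lap_pow_mem_P {k s : ℕ} {f : SuperPoly m n} (hf : f ∈ P m n (k + 2 * s)) :
    (lap m n ^ s) f ∈ P m n k := by
  induction s generalizing f with
  | zero => simpa using hf
  | succ s ih =>
    rw [pow_succ, Module.End.mul_apply]
    exact ih (lap_mem_P m n hf)

lemma lap_pow_eq_zero_of_mem_P {k s : ℕ} (hk : k < 2 * s) {f : SuperPoly m n}
    (hf : f ∈ P m n k) : (lap m n ^ s) f = 0 := by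
  obtain ⟨s, rfl⟩ : ∃ t, s = t + 1 := ⟨s - 1, by omega⟩
  have hd : s - k / 2 + (1 + k / 2) = s + 1 := by omega
  have h : (lap m n ^ (k / 2)) f ∈ P m n (k % 2) := by
    apply lap_pow_mem_P
    rwa [Nat.mod_add_div]
  rw [← hd, pow_add, pow_add, pow_one, Module.End.mul_apply, Module.End.mul_apply,
    lap_eq_zero_of_mem_P m n (by omega) h, map_zero]

lemma mul_mem_P {k l : ℕ} {f g : SuperPoly m n} (hf : f ∈ P m n k) (hg : g ∈ P m n l) :
    f * g ∈ P m n (k + l) := by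
  refine (P_le_iff m n (S := (P m n (k + l)).comap (LinearMap.mulRight ℝ g))).2 ?_ hf
  rintro a b rfl p hp w hw
  refine (P_le_iff m n (S := (P m n (a + b + l)).comap (LinearMap.mulLeft ℝ (p ⊗ₜ w)))).2 ?_ hg
  rintro c d rfl q hq u hu
  rw [Submodule.mem_comap, LinearMap.mulLeft_apply, Algebra.TensorProduct.tmul_mul_tmul,
    show a + b + (c + d) = a + c + (b + d) by ring]
  refine tmul_mem_P m n (hp.mul hq) ?_
  rw [fgrade, pow_add]
  exact Submodule.mul_mem_mul hw hu

lemma iSup_P : ⨆ k, P m n k = ⊤ := by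
  rw [eq_top_iff]
  rintro f -
  induction f using TensorProduct.induction_on with
  | zero => exact zero_mem _
  | add x y hx hy => exact add_mem hx hy
  | tmul p w =>
    have hw : w ∈ ⨆ b, fgrade n b := by
      have := CliffordAlgebra.iSup_ι_range_eq_top (0 : QuadraticForm ℝ (Fin (2 * n) → ℝ))
      rw [show (⨆ b, fgrade n b) = ⊤ from this]
      trivial
    refine Submodule.iSup_induction (fgrade n) (motive := fun w => p ⊗ₜ w ∈ ⨆ k, P m n k) hw ?_ ?_ ?_
    · intro b w hw
      rw [p.as_sum, TensorProduct.sum_tmul]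
      refine sum_mem fun d _ => ?_
      exact Submodule.mem_iSup_of_mem _ (tmul_mem_P m n (isHomogeneous_monomial _ rfl) hw)
    · rw [TensorProduct.tmul_zero]
      exact zero_mem _
    · intro x y hx hy
      rw [TensorProduct.tmul_add]
      exact add_mem hx hy

lemma one_mem_P : (1 : SuperPoly m n) ∈ P m n 0 :=
  tmul_mem_P m n (isHomogeneous_one _ _) (b := 0) (by rw [fgrade, pow_zero]; exact Submodule.mem_one.2 ⟨1, map_one _⟩)

lemma exists_smul_one_of_mem_P_zero {f : SuperPoly m n} (hf : f ∈ P m n 0) :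
    ∃ r : ℝ, f = r • 1 := by
  have : f ∈ Submodule.span ℝ {(1 : SuperPoly m n)} := by
    refine (P_le_iff m n).2 ?_ hf
    intro a b hab p hp w hw
    obtain ⟨rfl, rfl⟩ : a = 0 ∧ b = 0 := by omega
    rw [fgrade, pow_zero, Submodule.mem_one] at hw
    obtain ⟨r, rfl⟩ := hw
    rw [← totalDegree_zero_iff_isHomogeneous] at hp
    rw [totalDegree_eq_zero_iff_eq_C.1 hp, Submodule.mem_span_singleton]
    refine ⟨coeff 0 p * r, ?_⟩
    have h1 : algebraMap ℝ (Grass n) r = r • 1 := Algebra.algebraMap_eq_smul_one r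
    rw [h1, TensorProduct.tmul_smul, C_eq_smul_one, ← TensorProduct.smul_tmul',
      mul_comm (coeff 0 p), mul_smul]
    rfl
  obtain ⟨r, hr⟩ := Submodule.mem_span_singleton.1 this
  exact ⟨r, hr.symm⟩

lemma constTerm_tmul (p : MvPolynomial (Fin m) ℝ) (w : Grass n) :
    constTerm m n (p ⊗ₜ w) = aeval (fun _ : Fin m => (0 : ℝ)) p * ExteriorAlgebra.algebraMapInv w :=
  rfl

lemma constTerm_one : constTerm m n 1 = 1 := by
  rw [Algebra.TensorProduct.one_def, constTerm_tmul, map_one, map_one, mul_one]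

lemma constTerm_of_mem_P {k : ℕ} (hk : k ≠ 0) {f : SuperPoly m n} (hf : f ∈ P m n k) :
    constTerm m n f = 0 := by
  refine (P_le_iff m n (S := LinearMap.ker (constTerm m n))).2 ?_ hf
  intro a b hab p hp w hw
  rw [LinearMap.mem_ker, constTerm_tmul]
  rcases Nat.eq_zero_or_pos a with ha | ha
  · obtain ⟨b, rfl⟩ : ∃ c, b = c + 1 := ⟨b - 1, by omega⟩
    suffices fgrade n (b + 1) ≤ LinearMap.ker
        (ExteriorAlgebra.algebraMapInv (R := ℝ) (M := Fin (2 * n) → ℝ)).toLinearMap by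
      have := this hw
      rw [LinearMap.mem_ker] at this
      exact mul_eq_zero_of_right _ this
    rw [fgrade, pow_succ', Submodule.mul_le]
    rintro _ ⟨v, rfl⟩ u -
    rw [LinearMap.mem_ker, AlgHom.toLinearMap_apply, map_mul]
    simp [ExteriorAlgebra.algebraMapInv]
  · refine mul_eq_zero_of_left ?_ _
    rw [aeval_zero', constantCoeff_eq, hp.coeff_eq_zero (by simpa using ha.ne), map_zero]

/-! ### Commutation of the Laplace operator with the norm squared -/

lemma lapB_rb2_mul {a : ℕ} {p : MvPolynomial (Fin m) ℝ} (hp : p.IsHomogeneous a) :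
    lapB m (rb2 m * p) = rb2 m * lapB m p + (4 * (a : ℝ) + 2 * m) • p := by
  have key : ∀ j, lapB m (X j ^ 2 * p) =
      X j ^ 2 * lapB m p - (4 : ℝ) • (X j * pderiv j p) - (2 : ℝ) • p := by
    intro j
    rw [pow_two, mul_assoc, lapB_X_mul, lapB_X_mul, Derivation.leibniz, pderiv_X_self]
    simp only [smul_eq_mul, smul_eq_C_mul, map_ofNat]
    ring
  rw [rb2, neg_mul, neg_mul, Finset.sum_mul, map_neg, map_sum, Finset.sum_congr rfl fun j _ => key j,
    Finset.sum_sub_distrib, Finset.sum_sub_distrib, ← Finset.smul_sum, hp.sum_X_mul_pderiv,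
    ← Finset.sum_mul, Finset.sum_const, Finset.card_univ, Fintype.card_fin]
  simp only [← Nat.cast_smul_eq_nsmul ℝ, add_smul, mul_smul]
  rw [smul_comm (2 : ℝ)]
  abel

lemma lap_r2_mul {k : ℕ} {f : SuperPoly m n} (hf : f ∈ P m n k) :
    lap m n (r2 m n * f) = r2 m n * lap m n f + (4 * (k : ℝ) + 2 * (sdim m n : ℝ)) • f := by
  have := (P_le_iff m n (S := LinearMap.eqLocus
    (lap m n ∘ₗ LinearMap.mulLeft ℝ (r2 m n))
    (LinearMap.mulLeft ℝ (r2 m n) ∘ₗ lap m n +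
      (4 * (k : ℝ) + 2 * (sdim m n : ℝ)) • LinearMap.id))).2 ?_ hf
  · exact this
  rintro a b rfl p hp w hw
  change lap m n (r2 m n * p ⊗ₜ w) = r2 m n * lap m n (p ⊗ₜ w) +
    (4 * ((a + b : ℕ) : ℝ) + 2 * (sdim m n : ℝ)) • p ⊗ₜ w
  simp only [r2, add_mul, mul_add, Algebra.TensorProduct.tmul_mul_tmul, one_mul, lap_tmul, map_add,
    lapB_rb2_mul m hp, lapF_rf2_mul n hw, TensorProduct.tmul_add, TensorProduct.add_tmul,
    TensorProduct.tmul_smul, ← TensorProduct.smul_tmul']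
  rw [show 4 * ((a + b : ℕ) : ℝ) + 2 * (sdim m n : ℝ) =
    (4 * (a : ℝ) + 2 * m) + (4 * (b : ℝ) - 4 * n) by simp [sdim]; ring]
  generalize (4 * (a : ℝ) + 2 * m) = c
  rw [add_smul]
  abel

lemma r2_mem_P : r2 m n ∈ P m n 2 := by
  refine add_mem ?_ ?_
  · refine tmul_mem_P m n (a := 2) (b := 0) ?_ (by rw [fgrade, pow_zero]; exact Submodule.mem_one.2 ⟨1, map_one _⟩)
    rw [rb2, ← mem_homogeneousSubmodule]
    exact neg_mem
      (sum_mem fun j _ => (mem_homogeneousSubmodule _ _).2 (isHomogeneous_X_pow j 2))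
  · refine tmul_mem_P m n (a := 0) (b := 2) (isHomogeneous_one _ _) ?_
    rw [fgrade, pow_two]
    exact sum_mem fun j _ => Submodule.mul_mem_mul (LinearMap.mem_range_self _ _)
      (LinearMap.mem_range_self _ _)

lemma r2_pow_mul_mem_P {j q : ℕ} {h : SuperPoly m n} (hh : h ∈ P m n q) :
    r2 m n ^ j * h ∈ P m n (q + 2 * j) := by
  induction j with
  | zero => simpa using hh
  | succ j ih =>
    rw [pow_succ', mul_assoc]
    have := mul_mem_P m n (r2_mem_P m n) ih
    rwa [show 2 + (q + 2 * j) = q + 2 * (j + 1) by ring] at this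

lemma constTerm_lap_pow {k s : ℕ} (h : 2 * s ≠ k) {f : SuperPoly m n} (hf : f ∈ P m n k) :
    constTerm m n ((lap m n ^ s) f) = 0 := by
  rcases lt_or_gt_of_ne h with h | h
  · obtain ⟨l, rfl⟩ : ∃ l, k = l + 2 * s := ⟨k - 2 * s, by omega⟩
    exact constTerm_of_mem_P m n (by omega) (lap_pow_mem_P m n hf)
  · rw [lap_pow_eq_zero_of_mem_P m n h hf, map_zero]

/-! ### Orthogonality of harmonics -/

lemma lap_pow_mul_eq_zero {k l s : ℕ} (hs : k < s ∨ l < s) {f g : SuperPoly m n}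
    (hf : f ∈ H m n k) (hg : g ∈ H m n l) : (lap m n ^ s) (f * g) = 0 := by
  rcases hs with hs | hs
  · exact (adNil_mul_of_mem_P m n hf.1).1.pow_apply_eq_zero hs hg.2
  · exact (adNil_mul_of_mem_P m n hg.1).2.pow_apply_eq_zero hs hf.2

lemma constTerm_lap_pow_mul {k l : ℕ} (hkl : k ≠ l) (s : ℕ) {f g : SuperPoly m n}
    (hf : f ∈ H m n k) (hg : g ∈ H m n l) : constTerm m n ((lap m n ^ s) (f * g)) = 0 := by
  by_cases h : 2 * s = k + l
  · rw [lap_pow_mul_eq_zero m n (by omega) hf hg, map_zero]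
  · exact constTerm_lap_pow m n h (mul_mem_P m n hf.1 hg.1)

/-! ### The Fischer decomposition -/

/-- The scalar `c` with `Δ (x² ^ (i + 1) h) = c • x² ^ i h` for `h` harmonic of degree `q`. -/
def fischerCoeff (q i : ℕ) : ℝ := (i + 1) * (4 * q + 2 * (sdim m n : ℝ) + 4 * i)

lemma lap_r2_pow_succ_mul {q : ℕ} {h : SuperPoly m n} (hh : h ∈ H m n q) (i : ℕ) :
    lap m n (r2 m n ^ (i + 1) * h) = fischerCoeff m n q i • (r2 m n ^ i * h) := by
  induction i with
  | zero =>
    rw [zero_add, pow_one, pow_zero, one_mul, lap_r2_mul m n hh.1, LinearMap.mem_ker.1 hh.2,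
      mul_zero, zero_add]
    simp [fischerCoeff]
  | succ i ih =>
    rw [pow_succ' _ (i + 1), mul_assoc, lap_r2_mul m n (r2_pow_mul_mem_P m n hh.1), ih,
      mul_smul_comm, ← mul_assoc, ← pow_succ', ← add_smul]
    congr 1
    simp only [fischerCoeff]
    push_cast
    ring

lemma lap_pow_r2_pow_mul {q : ℕ} {h : SuperPoly m n} (hh : h ∈ H m n q) (s : ℕ) :
    (lap m n ^ s) (r2 m n ^ s * h) = (∏ i ∈ Finset.range s, fischerCoeff m n q i) • h := by
  induction s with
  | zero => simp
  | succ s ih =>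
    rw [pow_succ (lap m n), Module.End.mul_apply, lap_r2_pow_succ_mul m n hh, map_smul, ih,
      smul_smul, Finset.prod_range_succ, mul_comm (fischerCoeff m n q s)]

lemma lap_pow_r2_pow_mul_eq_zero {q : ℕ} {h : SuperPoly m n} (hh : h ∈ H m n q) {s j : ℕ}
    (hsj : j < s) : (lap m n ^ s) (r2 m n ^ j * h) = 0 := by
  obtain ⟨t, rfl⟩ : ∃ t, s = t + 1 + j := ⟨s - (j + 1), by omega⟩
  rw [pow_add, pow_add, pow_one, Module.End.mul_apply, Module.End.mul_apply,
    lap_pow_r2_pow_mul m n hh, map_smul, LinearMap.mem_ker.1 hh.2, smul_zero, map_zero]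

lemma fischerCoeff_ne_zero (hM : ∀ j : ℕ, sdim m n ≠ -(2 * (j : ℤ))) (q i : ℕ) :
    fischerCoeff m n q i ≠ 0 := by
  refine mul_ne_zero (by positivity) fun h => hM (q + i) ?_
  have : (sdim m n : ℝ) = ((-(2 * ((q + i : ℕ) : ℤ)) : ℤ) : ℝ) := by
    push_cast
    linarith
  exact_mod_cast this

lemma mem_span_of_mem_P (hM : ∀ j : ℕ, sdim m n ≠ -(2 * (j : ℤ))) {k : ℕ} (s : ℕ)
    {f : SuperPoly m n} (hf : f ∈ P m n k) (hs : (lap m n ^ s) f = 0) :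
    f ∈ Submodule.span ℝ {g | ∃ j q : ℕ, ∃ h ∈ H m n q, g = r2 m n ^ j * h} := by
  induction s generalizing f with
  | zero =>
    rw [pow_zero, Module.End.one_apply] at hs
    rw [hs]
    exact zero_mem _
  | succ s ih =>
    by_cases hk : k < 2 * s
    · exact ih hf (lap_pow_eq_zero_of_mem_P m n hk hf)
    obtain ⟨q, rfl⟩ : ∃ q, k = q + 2 * s := ⟨k - 2 * s, by omega⟩
    set h := (lap m n ^ s) f with hh
    have hH : h ∈ H m n q := by
      refine ⟨lap_pow_mem_P m n hf, ?_⟩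
      rwa [pow_succ', Module.End.mul_apply] at hs
    set c := ∏ i ∈ Finset.range s, fischerCoeff m n q i with hc
    have hc0 : c ≠ 0 := Finset.prod_ne_zero_iff.2 fun i _ => fischerCoeff_ne_zero m n hM q i
    have h1 := ih (f := f - c⁻¹ • (r2 m n ^ s * h))
      (sub_mem hf (Submodule.smul_mem _ _ (r2_pow_mul_mem_P m n hH.1))) (by
        rw [map_sub, map_smul, lap_pow_r2_pow_mul m n hH, ← hc, smul_smul, inv_mul_cancel₀ hc0,
          one_smul, ← hh, sub_self])
    have h2 := Submodule.smul_mem _ c⁻¹ (Submodule.subset_span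
      (s := {g | ∃ j q : ℕ, ∃ h ∈ H m n q, g = r2 m n ^ j * h}) ⟨s, q, h, hH, rfl⟩)
    simpa using add_mem h1 h2

lemma span_r2_pow_mul_harmonic (hM : ∀ j : ℕ, sdim m n ≠ -(2 * (j : ℤ))) :
    Submodule.span ℝ {g | ∃ j q : ℕ, ∃ h ∈ H m n q, g = r2 m n ^ j * h} = ⊤ := by
  rw [eq_top_iff, ← iSup_P, iSup_le_iff]
  exact fun k f hf => mem_span_of_mem_P m n hM (k + 1) hf
    (lap_pow_eq_zero_of_mem_P m n (by omega) hf)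

/-! ### The Pizzetti integral -/

/-- The coefficient of `(Δ^k R)(0)` in the Pizzetti integral. -/
def pizzettiCoeff (k : ℕ) : ℝ :=
  (-1 : ℝ) ^ k * (2 * Real.pi ^ ((sdim m n : ℝ) / 2) /
    (4 ^ k * k.factorial * Real.Gamma (k + (sdim m n : ℝ) / 2)))

lemma pizzettiCoeff_zero_ne_zero (hM : ∀ j : ℕ, sdim m n ≠ -(2 * (j : ℤ))) :
    pizzettiCoeff m n 0 ≠ 0 := by
  have hG : Real.Gamma ((sdim m n : ℝ) / 2) ≠ 0 := by
    refine Real.Gamma_ne_zero fun j h => hM j ?_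
    have : (sdim m n : ℝ) = ((-(2 * (j : ℤ)) : ℤ) : ℝ) := by
      push_cast
      linarith
    exact_mod_cast this
  have hpi : Real.pi ^ ((sdim m n : ℝ) / 2) ≠ 0 := (Real.rpow_pos_of_pos Real.pi_pos _).ne'
  simp [pizzettiCoeff, hG, hpi]

lemma pizzettiCoeff_succ_mul (hM : ∀ j : ℕ, sdim m n ≠ -(2 * (j : ℤ))) (s : ℕ) :
    pizzettiCoeff m n (s + 1) * fischerCoeff m n 0 s = -pizzettiCoeff m n s := by
  have h0 : (s : ℝ) + (sdim m n : ℝ) / 2 ≠ 0 := by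
    intro h
    refine hM s ?_
    have : (sdim m n : ℝ) = ((-(2 * (s : ℤ)) : ℤ) : ℝ) := by
      push_cast
      linarith
    exact_mod_cast this
  have e : fischerCoeff m n 0 s = 4 * (s + 1) * (s + (sdim m n : ℝ) / 2) := by
    simp only [fischerCoeff, Nat.cast_zero]
    ring
  have hG : Real.Gamma (((s + 1 : ℕ) : ℝ) + (sdim m n : ℝ) / 2) =
      (s + (sdim m n : ℝ) / 2) * Real.Gamma (s + (sdim m n : ℝ) / 2) := by
    rw [← Real.Gamma_add_one h0]
    congr 1
    push_cast
    ring
  rw [pizzettiCoeff, pizzettiCoeff, hG, e, Nat.factorial_succ]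
  generalize (s : ℝ) + (sdim m n : ℝ) / 2 = x at *
  have h1 : (s : ℝ) + 1 ≠ 0 := by positivity
  push_cast
  rw [pow_succ, pow_succ]
  generalize Real.Gamma x = G
  by_cases hG0 : G = 0
  · simp [hG0]
  · field_simp

lemma pizzettiCoeff_mul_prod (hM : ∀ j : ℕ, sdim m n ≠ -(2 * (j : ℤ))) (s : ℕ) :
    pizzettiCoeff m n s * ∏ i ∈ Finset.range s, fischerCoeff m n 0 i =
      (-1) ^ s * pizzettiCoeff m n 0 := by
  induction s with
  | zero => simp
  | succ s ih =>
    rw [Finset.prod_range_succ, mul_comm _ (fischerCoeff m n 0 s), ← mul_assoc,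
      pizzettiCoeff_succ_mul m n hM, neg_mul, ih, pow_succ]
    ring

lemma map_r2_pow_mul {T : SuperPoly m n →ₗ[ℝ] ℝ} (hT : ∀ f, T (r2 m n * f) = -T f) (j : ℕ)
    (f : SuperPoly m n) : T (r2 m n ^ j * f) = (-1) ^ j * T f := by
  induction j with
  | zero => simp
  | succ j ih =>
    rw [pow_succ', mul_assoc, hT, ih, pow_succ]
    ring

lemma one_mem_H : (1 : SuperPoly m n) ∈ H m n 0 :=
  ⟨one_mem_P m n, lap_eq_zero_of_mem_P m n (by omega) (one_mem_P m n)⟩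

lemma hasSum_of_vanishing_on_harmonics (hM : ∀ j : ℕ, sdim m n ≠ -(2 * (j : ℤ)))
    {T : SuperPoly m n →ₗ[ℝ] ℝ} (hT : ∀ f, T (r2 m n * f) = -T f)
    (hH : ∀ q, q ≠ 0 → ∀ h ∈ H m n q, T h = 0) (f : SuperPoly m n) :
    HasSum (fun s => T 1 / pizzettiCoeff m n 0 *
      (pizzettiCoeff m n s * constTerm m n ((lap m n ^ s) f))) (T f) := by
  have hf : f ∈ Submodule.span ℝ {g | ∃ j q : ℕ, ∃ h ∈ H m n q, g = r2 m n ^ j * h} := by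
    rw [span_r2_pow_mul_harmonic m n hM]
    trivial
  induction hf using Submodule.span_induction with
  | mem g hg =>
    obtain ⟨j, q, h, hh, rfl⟩ := hg
    rw [map_r2_pow_mul m n hT]
    by_cases hq : q = 0
    · subst hq
      obtain ⟨r, rfl⟩ := exists_smul_one_of_mem_P_zero m n hh.1
      have e : (-1) ^ j * T (r • 1) = T 1 / pizzettiCoeff m n 0 * (pizzettiCoeff m n j *
          constTerm m n ((lap m n ^ j) (r2 m n ^ j * r • 1))) := by
        rw [lap_pow_r2_pow_mul m n hh, map_smul, map_smul, map_smul, constTerm_one, smul_eq_mul,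
          smul_eq_mul, smul_eq_mul, ← mul_assoc (pizzettiCoeff m n j),
          pizzettiCoeff_mul_prod m n hM]
        have := pizzettiCoeff_zero_ne_zero m n hM
        field_simp
      rw [e]
      refine hasSum_single j fun s hs => ?_
      rw [constTerm_lap_pow m n (by omega) (r2_pow_mul_mem_P m n hh.1), mul_zero, mul_zero]
    · rw [hH q hq h hh, mul_zero]
      convert hasSum_zero using 1
      funext s
      suffices constTerm m n ((lap m n ^ s) (r2 m n ^ j * h)) = 0 by rw [this, mul_zero, mul_zero]
      by_cases hs : 2 * s = q + 2 * j
      · rw [lap_pow_r2_pow_mul_eq_zero m n hh (by omega), map_zero]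
      · exact constTerm_lap_pow m n hs (r2_pow_mul_mem_P m n hh.1)
  | zero => simp
  | add x y _ _ hx hy =>
    rw [map_add]
    convert hx.add hy using 2 with s
    rw [map_add, map_add]
    ring
  | smul r x _ hx =>
    rw [map_smul, smul_eq_mul]
    refine (hx.mul_left r).congr_fun fun s => ?_
    rw [map_smul, map_smul, smul_eq_mul]
    ring

/-- the Pizzetti integral makes spherical harmonics of different degrees
orthogonal, and it is (up to scalar) the unique integration over the supersphere
with this property. -/
theorem pizzetti_orthogonality_characterization (m n : ℕ) (hm : 1 ≤ m) (hn : 1 ≤ n)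
    (hM : ∀ j : ℕ, sdim m n ≠ -(2*(j:ℤ))) :
    (∀ k l : ℕ, k ≠ l → ∀ Hk ∈ H m n k, ∀ Hl ∈ H m n l,
      pizzetti m n (Hk * Hl) = 0) ∧
    (∀ T : SuperPoly m n →ₗ[ℝ] ℝ,
      (∀ f, T (r2 m n * f) = - T f) →
      (∀ A D, isSO m A → isSp n D → ∀ f, T (act m n A D f) = T f) →
      (∀ k l : ℕ, k ≠ l → ∀ Hk ∈ H m n k, ∀ Hl ∈ H m n l, T (Hk * Hl) = 0) →
      ∃ c : ℝ, ∀ f, T f = c * pizzetti m n f) := by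

  constructor
  · intro k l hkl f hf g hg
    rw [pizzetti]
    simp only [constTerm_lap_pow_mul m n hkl _ hf hg, mul_zero, tsum_zero]
  · intro T hT _ horth
    refine ⟨T 1 / pizzettiCoeff m n 0, fun f => ?_⟩
    have hH : ∀ q, q ≠ 0 → ∀ h ∈ H m n q, T h = 0 := fun q hq h hh => by
      simpa using horth 0 q hq.symm 1 (one_mem_H m n) h hh
    rw [← (hasSum_of_vanishing_on_harmonics m n hM hT hH f).tsum_eq, tsum_mul_left]
    rfl

end
end

section
/- Assume M ∉ {0, −2, −4, …}. Let (i, p, q) and (j, r, s) be two distinct triples of nonnegative integers with q ≤ n, s ≤ n, i ≤ n − q and j ≤ n − s. Then for all H^b_p ∈ ℋ^b_p, H^f_q ∈ ℋ^f_q, H^b_r ∈ ℋ^b_r and H^f_s ∈ ℋ^f_s: ∫_SS ( f_{i,p,q} H^b_p H^f_q · f_{j,r,s} H^b_r H^f_s ) = 0. -/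
set_option synthInstance.maxHeartbeats 1000000
set_option maxHeartbeats 1000000
open scoped TensorProduct
open MvPolynomial Matrix

noncomputable section

variable (m n : ℕ)

/-- f_{k,p,q}, with the convention f_{0,p,n} = 1 when q = n. -/
def fkpqC (m n k p q : ℕ) : SuperPoly m n :=
  if q = n then 1 else fkpq m n k p q

/-- A super Laplacian on a real algebra: an operator `Δ` with a Leibniz rule of second order, an Euler
operator `E`, an evaluation `ε` at the origin and a squared norm `ρ` satisfying the `sl₂` relation
`[Δ, ρ] = c + 4 E`. -/
structure LaplaceSystem (A ι : Type*) [Ring A] [Algebra ℝ A] [Fintype ι] where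
  Δ : A →ₗ[ℝ] A
  E : A →ₗ[ℝ] A
  ε : A →ₗ[ℝ] ℝ
  ρ : A
  c : ℝ
  u : ι → A →ₗ[ℝ] A
  v : ι → A →ₗ[ℝ] A
  Δ_mul : ∀ x y, Δ (x * y) = Δ x * y + x * Δ y + ∑ t, u t x * v t y
  E_mul : ∀ x y, E (x * y) = E x * y + x * E y
  ε_mul : ∀ x y, ε (x * y) = ε x * ε y
  ε_E : ∀ x, ε (E x) = 0
  Δ_u : ∀ t x, Δ (u t x) = u t (Δ x)
  Δ_v : ∀ t x, Δ (v t x) = v t (Δ x)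
  E_u : ∀ t x, E (u t x) = u t (E x) - u t x
  E_v : ∀ t x, E (v t x) = v t (E x) - v t x
  E_ρ : E ρ = (2 : ℝ) • ρ
  Δ_ρ_mul : ∀ x, Δ (ρ * x) = ρ * Δ x + (c • x + (4 : ℝ) • E x)

namespace LaplaceSystem

variable {A B ι κ : Type*} [Ring A] [Algebra ℝ A] [Ring B] [Algebra ℝ B] [Fintype ι] [Fintype κ]

/-- The harmonic elements of degree `α`. -/
def harmonic (S : LaplaceSystem A ι) (α : ℝ) : Submodule ℝ A :=
  LinearMap.ker S.Δ ⊓ Module.End.eigenspace S.E α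

theorem mem_harmonic (S : LaplaceSystem A ι) {α : ℝ} {x : A} :
    x ∈ S.harmonic α ↔ S.Δ x = 0 ∧ S.E x = α • x := by
  simp [harmonic]

theorem u_mem_harmonic (S : LaplaceSystem A ι) {α : ℝ} {x : A} (hx : x ∈ S.harmonic α) (t : ι) :
    S.u t x ∈ S.harmonic (α - 1) := by
  rw [mem_harmonic] at *
  rw [S.Δ_u, S.E_u, hx.1, hx.2, map_zero, map_smul, sub_smul, one_smul]
  simp

theorem v_mem_harmonic (S : LaplaceSystem A ι) {α : ℝ} {x : A} (hx : x ∈ S.harmonic α) (t : ι) :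
    S.v t x ∈ S.harmonic (α - 1) := by
  rw [mem_harmonic] at *
  rw [S.Δ_v, S.E_v, hx.1, hx.2, map_zero, map_smul, sub_smul, one_smul]
  simp

theorem ε_eq_zero (S : LaplaceSystem A ι) {α : ℝ} (hα : α ≠ 0) {x : A} (hx : x ∈ S.harmonic α) :
    S.ε x = 0 := by
  have h := S.ε_E x
  rw [((S.mem_harmonic).1 hx).2, map_smul, smul_eq_mul] at h
  exact (mul_eq_zero.1 h).resolve_left hα

theorem E_ρ_pow_mul (S : LaplaceSystem A ι) {e : ℝ} {x : A} (hx : S.E x = e • x) (k : ℕ) :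
    S.E (S.ρ ^ k * x) = (e + 2 * k) • (S.ρ ^ k * x) := by
  induction k with
  | zero => simp [hx]
  | succ k ih =>
    rw [pow_succ', mul_assoc, S.E_mul, ih, S.E_ρ, mul_smul_comm, smul_mul_assoc, ← add_smul]
    congr 1
    push_cast
    ring

theorem Δ_ρ_pow_mul (S : LaplaceSystem A ι) {e : ℝ} {x : A} (hx : S.E x = e • x) (k : ℕ) :
    S.Δ (S.ρ ^ k * x) =
      S.ρ ^ k * S.Δ x + (k * (S.c + 4 * e + 4 * (k - 1)) : ℝ) • (S.ρ ^ (k - 1) * x) := by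
  induction k with
  | zero => simp
  | succ k ih =>
    rw [pow_succ', mul_assoc, S.Δ_ρ_mul, ih, S.E_ρ_pow_mul hx, mul_add, ← mul_assoc, mul_smul_comm]
    rcases k with _ | k
    · simp only [Nat.cast_zero, pow_zero, one_mul]
      simp
      module
    · simp only [Nat.add_sub_cancel]
      rw [← mul_assoc S.ρ (S.ρ ^ k), ← pow_succ' S.ρ k, ← pow_succ' S.ρ (k + 1)]
      push_cast
      module

/-- The span of the products `ρ ^ k * (x * y)` with `x`, `y` harmonic of different degrees. -/
def mixed (S : LaplaceSystem A ι) : Submodule ℝ A :=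
  Submodule.span ℝ {z | ∃ (k : ℕ) (α β : ℝ) (x y : A), α ≠ β ∧ x ∈ S.harmonic α ∧
    y ∈ S.harmonic β ∧ z = S.ρ ^ k * (x * y)}

theorem mem_mixed (S : LaplaceSystem A ι) (k : ℕ) {α β : ℝ} (h : α ≠ β) {x y : A}
    (hx : x ∈ S.harmonic α) (hy : y ∈ S.harmonic β) : S.ρ ^ k * (x * y) ∈ S.mixed :=
  Submodule.subset_span ⟨k, α, β, x, y, h, hx, hy, rfl⟩

theorem ε_mixed (S : LaplaceSystem A ι) : S.mixed ≤ LinearMap.ker S.ε := by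
  refine Submodule.span_le.2 ?_
  rintro _ ⟨k, α, β, x, y, h, hx, hy, rfl⟩
  rw [SetLike.mem_coe, LinearMap.mem_ker, S.ε_mul, S.ε_mul]
  by_cases hα : α = 0
  · rw [S.ε_eq_zero (hα ▸ h.symm) hy]
    simp
  · rw [S.ε_eq_zero hα hx]
    simp

theorem Δ_mixed (S : LaplaceSystem A ι) : S.mixed ≤ S.mixed.comap S.Δ := by
  refine Submodule.span_le.2 ?_
  rintro _ ⟨k, α, β, x, y, h, hx, hy, rfl⟩
  obtain ⟨hx0, hxE⟩ := S.mem_harmonic.1 hx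
  obtain ⟨hy0, hyE⟩ := S.mem_harmonic.1 hy
  have hE : S.E (x * y) = (α + β) • (x * y) := by
    rw [S.E_mul, hxE, hyE, smul_mul_assoc, mul_smul_comm, add_smul]
  rw [SetLike.mem_coe, Submodule.mem_comap, S.Δ_ρ_pow_mul hE, S.Δ_mul, hx0, hy0, zero_mul,
    mul_zero, zero_add, zero_add, Finset.mul_sum]
  refine S.mixed.add_mem (S.mixed.sum_mem fun t _ => ?_) (S.mixed.smul_mem _ ?_)
  · exact S.mem_mixed k (by simpa using h) (S.u_mem_harmonic hx t) (S.v_mem_harmonic hy t)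
  · exact S.mem_mixed _ h hx hy

/-- A subspace on which `ε` vanishes and which is stable under `Δ` is killed by all `ε ∘ Δ ^ k`. -/
theorem ε_Δ_pow_eq_zero {Δ : A →ₗ[ℝ] A} {ε : A →ₗ[ℝ] ℝ} {T : Submodule ℝ A}
    (hε : T ≤ LinearMap.ker ε) (hΔ : T ≤ T.comap Δ) {x : A} (hx : x ∈ T) (k : ℕ) :
    ε ((Δ ^ k) x) = 0 := by
  suffices h : (Δ ^ k) x ∈ T from hε h
  induction k with
  | zero => simpa
  | succ k ih =>
    rw [pow_succ', Module.End.mul_apply]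
    exact hΔ ih

/-- The Laplace system on a tensor product, with Laplacian `Δ ⊗ 1 + 1 ⊗ Δ`. -/
def tensor (S : LaplaceSystem A ι) (T : LaplaceSystem B κ) :
    LaplaceSystem (A ⊗[ℝ] B) (ι ⊕ κ) where
  Δ := S.Δ.rTensor B + T.Δ.lTensor A
  E := S.E.rTensor B + T.E.lTensor A
  ε := (TensorProduct.lid ℝ ℝ).toLinearMap ∘ₗ TensorProduct.map S.ε T.ε
  ρ := S.ρ ⊗ₜ 1 + 1 ⊗ₜ T.ρ
  c := S.c + T.c
  u := Sum.elim (fun t => (S.u t).rTensor B) (fun t => (T.u t).lTensor A)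
  v := Sum.elim (fun t => (S.v t).rTensor B) (fun t => (T.v t).lTensor A)
  Δ_mul x y := by
    induction x with
    | zero => simp
    | add x₁ x₂ h₁ h₂ =>
      simp only [add_mul, map_add, h₁, h₂, Finset.sum_add_distrib]
      abel
    | tmul a b =>
      induction y with
      | zero => simp
      | add y₁ y₂ h₁ h₂ =>
        simp only [mul_add, map_add, h₁, h₂, Finset.sum_add_distrib]
        abel
      | tmul a' b' =>
        simp only [Algebra.TensorProduct.tmul_mul_tmul, LinearMap.add_apply,
          LinearMap.rTensor_tmul, LinearMap.lTensor_tmul, Fintype.sum_sum_type, Sum.elim_inl,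
          Sum.elim_inr, S.Δ_mul, T.Δ_mul, TensorProduct.add_tmul, TensorProduct.tmul_add, add_mul,
          mul_add, TensorProduct.sum_tmul, TensorProduct.tmul_sum]
        abel
  E_mul x y := by
    induction x with
    | zero => simp
    | add x₁ x₂ h₁ h₂ =>
      simp only [add_mul, map_add, h₁, h₂]
      abel
    | tmul a b =>
      induction y with
      | zero => simp
      | add y₁ y₂ h₁ h₂ =>
        simp only [mul_add, map_add, h₁, h₂]
        abel
      | tmul a' b' =>
        simp only [Algebra.TensorProduct.tmul_mul_tmul, LinearMap.add_apply,
          LinearMap.rTensor_tmul, LinearMap.lTensor_tmul, S.E_mul, T.E_mul,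
          TensorProduct.add_tmul, TensorProduct.tmul_add, add_mul, mul_add]
        abel
  ε_mul x y := by
    induction x with
    | zero => simp
    | add x₁ x₂ h₁ h₂ => rw [add_mul, map_add, map_add, h₁, h₂, add_mul]
    | tmul a b =>
      induction y with
      | zero => simp
      | add y₁ y₂ h₁ h₂ => rw [mul_add, map_add, map_add, h₁, h₂, mul_add]
      | tmul a' b' =>
        simp only [Algebra.TensorProduct.tmul_mul_tmul, LinearMap.comp_apply,
          TensorProduct.map_tmul, LinearEquiv.coe_coe, TensorProduct.lid_tmul, S.ε_mul, T.ε_mul,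
          smul_eq_mul]
        ring
  ε_E x := by
    induction x with
    | zero => simp
    | add x₁ x₂ h₁ h₂ => rw [map_add, map_add, h₁, h₂, add_zero]
    | tmul a b => simp [S.ε_E, T.ε_E]
  Δ_u t x := by
    induction x with
    | zero => simp
    | add x₁ x₂ h₁ h₂ => simp only [map_add, h₁, h₂]
    | tmul a b => rcases t with t | t <;> simp [S.Δ_u, T.Δ_u]
  Δ_v t x := by
    induction x with
    | zero => simp
    | add x₁ x₂ h₁ h₂ => simp only [map_add, h₁, h₂]
    | tmul a b => rcases t with t | t <;> simp [S.Δ_v, T.Δ_v]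
  E_u t x := by
    induction x with
    | zero => simp
    | add x₁ x₂ h₁ h₂ =>
      simp only [map_add, h₁, h₂]
      abel
    | tmul a b =>
      rcases t with t | t <;>
        simp [S.E_u, T.E_u, TensorProduct.sub_tmul, TensorProduct.tmul_sub] <;> abel
  E_v t x := by
    induction x with
    | zero => simp
    | add x₁ x₂ h₁ h₂ =>
      simp only [map_add, h₁, h₂]
      abel
    | tmul a b =>
      rcases t with t | t <;>
        simp [S.E_v, T.E_v, TensorProduct.sub_tmul, TensorProduct.tmul_sub] <;> abel
  E_ρ := by
    have hS : S.E 1 = 0 := by simpa using S.E_mul 1 1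
    have hT : T.E 1 = 0 := by simpa using T.E_mul 1 1
    simp [hS, hT, S.E_ρ, T.E_ρ, TensorProduct.smul_tmul']
  Δ_ρ_mul x := by
    induction x with
    | zero => simp
    | add x₁ x₂ h₁ h₂ =>
      simp only [mul_add, map_add, h₁, h₂, smul_add]
      abel
    | tmul a b =>
      simp only [add_mul, mul_add, Algebra.TensorProduct.tmul_mul_tmul, one_mul, map_add,
        LinearMap.add_apply, LinearMap.rTensor_tmul, LinearMap.lTensor_tmul, S.Δ_ρ_mul, T.Δ_ρ_mul,
        TensorProduct.add_tmul, TensorProduct.tmul_add, TensorProduct.tmul_smul,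
        ← TensorProduct.smul_tmul', add_smul, smul_add]
      abel

end LaplaceSystem

namespace Grass

open CliffordAlgebra in
theorem ι_mul_involute (v : Fin (2 * n) → ℝ) (x : Grass n) :
    ExteriorAlgebra.ι ℝ v * involute x = x * ExteriorAlgebra.ι ℝ v := by
  induction x using ExteriorAlgebra.induction with
  | algebraMap r => rw [AlgHom.commutes, Algebra.commutes]
  | ι w =>
    rw [show involute (ExteriorAlgebra.ι ℝ w) = -ExteriorAlgebra.ι ℝ w from involute_ι w, mul_neg]
    exact neg_eq_of_add_eq_zero_right (ExteriorAlgebra.ι_add_mul_swap v w)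
  | mul a b ha hb => rw [map_mul, ← mul_assoc, ha, mul_assoc, hb, mul_assoc]
  | add a b ha hb => rw [map_add, mul_add, ha, hb, add_mul]

theorem involute_ι (w : Fin (2 * n) → ℝ) :
    CliffordAlgebra.involute (ExteriorAlgebra.ι ℝ w) = -ExteriorAlgebra.ι ℝ w :=
  CliffordAlgebra.involute_ι w

theorem involute_fgen (i : Fin (2 * n)) : CliffordAlgebra.involute (fgen n i) = -fgen n i :=
  involute_ι n _

theorem fpderiv_algebraMap (i : Fin (2 * n)) (r : ℝ) :
    fpderiv n i (algebraMap ℝ (Grass n) r) = 0 :=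
  CliffordAlgebra.contractLeft_algebraMap _ _ _

theorem fpderiv_ι (i : Fin (2 * n)) (w : Fin (2 * n) → ℝ) :
    fpderiv n i (ExteriorAlgebra.ι ℝ w) = algebraMap ℝ (Grass n) (w i) :=
  CliffordAlgebra.contractLeft_ι _ _ _

theorem fpderiv_fgen_mul (i k : Fin (2 * n)) (x : Grass n) :
    fpderiv n i (fgen n k * x) = (if i = k then x else 0) - fgen n k * fpderiv n i x := by
  refine (CliffordAlgebra.contractLeft_ι_mul _ _ _).trans ?_
  rw [LinearMap.proj_apply, Pi.single_apply, ite_smul, one_smul, zero_smul]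
  rfl

theorem fpderiv_fgen (i k : Fin (2 * n)) :
    fpderiv n i (fgen n k) = if i = k then 1 else 0 := by
  rw [fgen, fpderiv_ι, Pi.single_apply]
  split_ifs <;> simp

theorem fpderiv_mul (i : Fin (2 * n)) (x y : Grass n) :
    fpderiv n i (x * y) = fpderiv n i x * y + CliffordAlgebra.involute x * fpderiv n i y := by
  induction x using ExteriorAlgebra.induction generalizing y with
  | algebraMap r =>
    rw [fpderiv_algebraMap, zero_mul, zero_add, AlgHom.commutes]
    exact CliffordAlgebra.contractLeft_algebraMap_mul _ _ _
  | ι w =>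
    rw [show fpderiv n i (ExteriorAlgebra.ι ℝ w * y) = w i • y - ExteriorAlgebra.ι ℝ w *
        fpderiv n i y from CliffordAlgebra.contractLeft_ι_mul _ _ _,
      fpderiv_ι, involute_ι, Algebra.smul_def, neg_mul, sub_eq_add_neg]
  | mul a b ha hb =>
    rw [mul_assoc, ha, hb, ha, map_mul]
    noncomm_ring
  | add a b ha hb =>
    rw [add_mul, map_add, map_add, map_add, ha, hb]
    noncomm_ring

theorem fpderiv_involute (i : Fin (2 * n)) (x : Grass n) :
    fpderiv n i (CliffordAlgebra.involute x) = -CliffordAlgebra.involute (fpderiv n i x) := by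
  induction x using ExteriorAlgebra.induction with
  | algebraMap r =>
    rw [AlgHom.commutes, fpderiv_algebraMap, map_zero, neg_zero]
  | ι w =>
    rw [involute_ι, map_neg, fpderiv_ι, AlgHom.commutes]
  | mul a b ha hb =>
    rw [map_mul, fpderiv_mul, ha, hb, fpderiv_mul, map_add, map_mul, map_mul]
    noncomm_ring
  | add a b ha hb =>
    rw [map_add, map_add, ha, hb, map_add, map_add, neg_add]

theorem fpderiv_comm (i k : Fin (2 * n)) (x : Grass n) :
    fpderiv n i (fpderiv n k x) = -fpderiv n k (fpderiv n i x) :=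
  CliffordAlgebra.contractLeft_comm _ _ _

theorem lapF_apply (x : Grass n) : lapF n x = ∑ j : Fin n, (4 : ℝ) •
    fpderiv n ⟨2 * j.1, by omega⟩ (fpderiv n ⟨2 * j.1 + 1, by omega⟩ x) := by
  simp [lapF, Finset.smul_sum]

theorem lapF_fpderiv (i : Fin (2 * n)) (x : Grass n) :
    lapF n (fpderiv n i x) = fpderiv n i (lapF n x) := by
  rw [lapF_apply, lapF_apply, map_sum]
  refine Finset.sum_congr rfl fun j _ => ?_
  rw [map_smul, fpderiv_comm n _ i x, map_neg, fpderiv_comm n _ i (fpderiv n _ x), neg_neg]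

theorem lapF_involute (x : Grass n) :
    lapF n (CliffordAlgebra.involute x) = CliffordAlgebra.involute (lapF n x) := by
  rw [lapF_apply, lapF_apply, map_sum]
  refine Finset.sum_congr rfl fun j _ => ?_
  rw [map_smul, fpderiv_involute, map_neg, fpderiv_involute, neg_neg]

theorem lapF_mul (x y : Grass n) : lapF n (x * y) = lapF n x * y + x * lapF n y +
    ∑ j : Fin n, (4 : ℝ) • (
      CliffordAlgebra.involute (fpderiv n ⟨2 * j.1 + 1, by omega⟩ x) *
        fpderiv n ⟨2 * j.1, by omega⟩ y -
      CliffordAlgebra.involute (fpderiv n ⟨2 * j.1, by omega⟩ x) *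
        fpderiv n ⟨2 * j.1 + 1, by omega⟩ y) := by
  simp only [lapF_apply, Finset.sum_mul, Finset.mul_sum, ← Finset.sum_add_distrib]
  refine Finset.sum_congr rfl fun j _ => ?_
  rw [fpderiv_mul, map_add, fpderiv_mul, fpderiv_mul, fpderiv_involute,
    CliffordAlgebra.involute_involute, smul_mul_assoc, mul_smul_comm, ← smul_add, ← smul_add]
  congr 1
  noncomm_ring

/-- The fermionic Euler operator. -/
def euler : Grass n →ₗ[ℝ] Grass n :=
  ∑ i : Fin (2 * n), LinearMap.mulLeft ℝ (fgen n i) ∘ₗ fpderiv n i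

theorem euler_apply (x : Grass n) : euler n x = ∑ i, fgen n i * fpderiv n i x := by
  simp [euler]

theorem euler_mul (x y : Grass n) : euler n (x * y) = euler n x * y + x * euler n y := by
  simp only [euler_apply, Finset.sum_mul, Finset.mul_sum, ← Finset.sum_add_distrib]
  refine Finset.sum_congr rfl fun i _ => ?_
  rw [fpderiv_mul, mul_add, ← mul_assoc, ← mul_assoc, ← mul_assoc]
  congr 2
  exact ι_mul_involute n _ _

theorem euler_fpderiv (i : Fin (2 * n)) (x : Grass n) :
    euler n (fpderiv n i x) = fpderiv n i (euler n x) - fpderiv n i x := by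
  simp only [euler_apply, map_sum, fpderiv_fgen_mul, Finset.sum_sub_distrib,
    Finset.sum_ite_eq, Finset.mem_univ, if_true, fpderiv_comm n i, mul_neg, Finset.sum_neg_distrib]
  abel

theorem euler_involute (x : Grass n) :
    euler n (CliffordAlgebra.involute x) = CliffordAlgebra.involute (euler n x) := by
  rw [euler_apply, euler_apply, map_sum]
  refine Finset.sum_congr rfl fun i _ => ?_
  rw [fpderiv_involute, map_mul, involute_fgen, mul_neg, neg_mul]

theorem euler_ι (w : Fin (2 * n) → ℝ) :
    euler n (ExteriorAlgebra.ι ℝ w) = ExteriorAlgebra.ι ℝ w := by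
  rw [euler_apply]
  conv_rhs => rw [pi_eq_sum_univ' w, map_sum]
  refine Finset.sum_congr rfl fun i _ => ?_
  rw [fpderiv_ι, map_smul, Algebra.smul_def, ← Algebra.commutes, fgen]

theorem euler_of_mem_fgrade {q : ℕ} {x : Grass n} (hx : x ∈ fgrade n q) :
    euler n x = (q : ℝ) • x := by
  have h1 : euler n 1 = 0 := by simpa using euler_mul n 1 1
  induction hx using Submodule.pow_induction_on_left' with
  | algebraMap r => simp [Algebra.algebraMap_eq_smul_one, h1]
  | add x y i _ _ hx hy => rw [map_add, hx, hy, smul_add]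
  | mem_mul w hw i x _ hx =>
    obtain ⟨v, rfl⟩ := hw
    rw [euler_mul, euler_ι, hx, mul_smul_comm]
    push_cast
    module

theorem sum_univ_two_mul {M : Type*} [AddCommMonoid M] (g : Fin (2 * n) → M) :
    ∑ i, g i = ∑ j : Fin n, (g ⟨2 * j.1, by omega⟩ + g ⟨2 * j.1 + 1, by omega⟩) := by
  rw [← Fintype.sum_equiv (finProdFinEquiv.trans (finCongr (mul_comm n 2))) _ g fun _ => rfl,
    Fintype.sum_prod_type]
  refine Finset.sum_congr rfl fun j _ => ?_
  rw [Fin.sum_univ_two]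
  congr 2 <;> ext <;> simp; omega

theorem fpderiv_even_rf2 (j : Fin n) :
    fpderiv n ⟨2 * j.1, by omega⟩ (rf2 n) = fgen n ⟨2 * j.1 + 1, by omega⟩ := by
  rw [rf2, map_sum, Finset.sum_eq_single_of_mem j (Finset.mem_univ j)]
  · simp [fpderiv_fgen_mul, fpderiv_fgen]
  · intro k _ hk
    rw [fpderiv_fgen_mul, fpderiv_fgen, if_neg, if_neg, mul_zero, sub_zero]
    · simp only [Fin.mk.injEq]; omega
    · simp only [Fin.mk.injEq]; omega

theorem fpderiv_odd_rf2 (j : Fin n) :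
    fpderiv n ⟨2 * j.1 + 1, by omega⟩ (rf2 n) = -fgen n ⟨2 * j.1, by omega⟩ := by
  rw [rf2, map_sum, Finset.sum_eq_single_of_mem j (Finset.mem_univ j)]
  · simp [fpderiv_fgen_mul, fpderiv_fgen]
  · intro k _ hk
    rw [fpderiv_fgen_mul, fpderiv_fgen, if_neg, if_neg, mul_zero, sub_zero]
    · simp only [Fin.mk.injEq]; omega
    · simp only [Fin.mk.injEq]; omega

theorem lapF_rf2 : lapF n (rf2 n) = (-4 * n : ℝ) • 1 := by
  rw [lapF_apply]
  simp only [fpderiv_odd_rf2, map_neg, fpderiv_fgen, if_true, Finset.sum_const, Finset.card_univ,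
    Fintype.card_fin]
  module

theorem lapF_rf2_mul (x : Grass n) :
    lapF n (rf2 n * x) = rf2 n * lapF n x + ((-4 * n : ℝ) • x + (4 : ℝ) • euler n x) := by
  rw [lapF_mul, lapF_rf2, smul_mul_assoc, one_mul, euler_apply, sum_univ_two_mul, Finset.smul_sum]
  rw [add_comm ((-4 * n : ℝ) • x), add_assoc]
  congr 2
  refine Finset.sum_congr rfl fun j _ => ?_
  rw [fpderiv_odd_rf2, fpderiv_even_rf2, map_neg,
    involute_fgen, involute_fgen, neg_neg, neg_mul, sub_neg_eq_add]

theorem euler_rf2 : euler n (rf2 n) = (2 : ℝ) • rf2 n := by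
  rw [rf2, map_sum, Finset.smul_sum]
  refine Finset.sum_congr rfl fun j _ => ?_
  rw [euler_mul, fgen, fgen, euler_ι, euler_ι]
  module

theorem commute_rf2 (x : Grass n) : Commute (rf2 n) x := by
  have h : ∀ i, ∀ y : Grass n, fgen n i * CliffordAlgebra.involute y = y * fgen n i :=
    fun i y => ι_mul_involute n _ y
  have h' : ∀ i, ∀ y : Grass n, fgen n i * y = CliffordAlgebra.involute y * fgen n i :=
    fun i y => by rw [← h, CliffordAlgebra.involute_involute]
  refine Commute.sum_left _ _ _ fun j _ => ?_
  rw [Commute, SemiconjBy, mul_assoc, h' _ x, ← mul_assoc, h, mul_assoc]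

theorem algebraMapInv_euler (x : Grass n) :
    ExteriorAlgebra.algebraMapInv (euler n x) = 0 := by
  rw [euler_apply, map_sum]
  refine Finset.sum_eq_zero fun i _ => ?_
  rw [map_mul, fgen, ExteriorAlgebra.algebraMapInv, ExteriorAlgebra.lift_ι_apply]
  simp

end Grass

/-- The fermionic Laplace system. -/
def fermionicSystem : LaplaceSystem (Grass n) (Fin n ⊕ Fin n) where
  Δ := lapF n
  E := Grass.euler n
  ε := ExteriorAlgebra.algebraMapInv.toLinearMap
  ρ := rf2 n
  c := -4 * n
  u := Sum.elim
    (fun j => (4 : ℝ) •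
      CliffordAlgebra.involute.toLinearMap ∘ₗ fpderiv n ⟨2 * j.1 + 1, by omega⟩)
    (fun j => (-4 : ℝ) •
      CliffordAlgebra.involute.toLinearMap ∘ₗ fpderiv n ⟨2 * j.1, by omega⟩)
  v := Sum.elim (fun j => fpderiv n ⟨2 * j.1, by omega⟩)
    (fun j => fpderiv n ⟨2 * j.1 + 1, by omega⟩)
  Δ_mul x y := by
    simp only [Grass.lapF_mul, Fintype.sum_sum_type, Sum.elim_inl, Sum.elim_inr,
      ← Finset.sum_add_distrib, LinearMap.smul_apply, LinearMap.comp_apply,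
      AlgHom.toLinearMap_apply, smul_mul_assoc]
    congr 1
    refine Finset.sum_congr rfl fun j _ => ?_
    module
  E_mul := Grass.euler_mul n
  ε_mul x y := map_mul (ExteriorAlgebra.algebraMapInv (R := ℝ)) x y
  ε_E := Grass.algebraMapInv_euler n
  Δ_u t x := by rcases t with t | t <;> simp [Grass.lapF_involute, Grass.lapF_fpderiv]
  Δ_v t x := by rcases t with t | t <;> simp [Grass.lapF_fpderiv]
  E_u t x := by
    rcases t with t | t <;>
      simp only [Sum.elim_inl, Sum.elim_inr, LinearMap.smul_apply, LinearMap.comp_apply,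
        AlgHom.toLinearMap_apply, map_smul, Grass.euler_involute, Grass.euler_fpderiv, map_sub,
        smul_sub]
  E_v t x := by rcases t with t | t <;> simp [Grass.euler_fpderiv]
  E_ρ := Grass.euler_rf2 n
  Δ_ρ_mul := Grass.lapF_rf2_mul n

namespace MvPolynomial

variable {σ R : Type*}

theorem pderiv_pderiv_comm [CommRing R] (i j : σ) (f : MvPolynomial σ R) :
    pderiv i (pderiv j f) = pderiv j (pderiv i f) := by
  classical
  have h : ⁅pderiv (R := R) i, pderiv (R := R) j⁆ = 0 := by
    refine derivation_ext fun k => ?_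
    rw [Derivation.commutator_apply, pderiv_X, pderiv_X, Pi.single_apply, Pi.single_apply]
    split_ifs <;> simp
  have h' := Derivation.congr_fun h f
  rwa [Derivation.commutator_apply, Derivation.zero_apply, sub_eq_zero] at h'

/-- The bosonic Euler operator. -/
def euler : MvPolynomial (Fin m) ℝ →ₗ[ℝ] MvPolynomial (Fin m) ℝ :=
  ∑ i : Fin m, LinearMap.mulLeft ℝ (X i) ∘ₗ (pderiv i).toLinearMap

theorem euler_apply (f : MvPolynomial (Fin m) ℝ) : euler m f = ∑ i, X i * pderiv i f := by
  simp [euler]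

theorem euler_mul (f g : MvPolynomial (Fin m) ℝ) :
    euler m (f * g) = euler m f * g + f * euler m g := by
  simp only [euler_apply, Finset.sum_mul, Finset.mul_sum, ← Finset.sum_add_distrib]
  refine Finset.sum_congr rfl fun i _ => ?_
  rw [pderiv_mul]
  ring

theorem euler_pderiv (i : Fin m) (f : MvPolynomial (Fin m) ℝ) :
    euler m (pderiv i f) = pderiv i (euler m f) - pderiv i f := by
  simp only [euler_apply, map_sum, pderiv_mul, pderiv_X, Pi.single_apply, ite_mul, one_mul,
    zero_mul, Finset.sum_add_distrib, Finset.sum_ite_eq', Finset.mem_univ,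
    if_true, pderiv_pderiv_comm i]
  abel

theorem lapB_apply (f : MvPolynomial (Fin m) ℝ) :
    lapB m f = ∑ j, -pderiv j (pderiv j f) := by
  simp [lapB]

theorem lapB_pderiv (i : Fin m) (f : MvPolynomial (Fin m) ℝ) :
    lapB m (pderiv i f) = pderiv i (lapB m f) := by
  rw [lapB_apply, lapB_apply, map_sum]
  refine Finset.sum_congr rfl fun j _ => ?_
  rw [map_neg, pderiv_pderiv_comm j i f, pderiv_pderiv_comm j i (pderiv j f)]

theorem lapB_mul (f g : MvPolynomial (Fin m) ℝ) : lapB m (f * g) = lapB m f * g + f * lapB m g +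
    ∑ j, (-2 : ℝ) • pderiv j f * pderiv j g := by
  simp only [lapB_apply, Finset.sum_mul, Finset.mul_sum, ← Finset.sum_add_distrib]
  refine Finset.sum_congr rfl fun j _ => ?_
  simp only [pderiv_mul, map_add, neg_smul, ofNat_smul_eq_nsmul, nsmul_eq_mul]
  push_cast
  ring

theorem pderiv_rb2 (j : Fin m) : pderiv j (rb2 m) = (-2 : ℝ) • X j := by
  simp [rb2, pderiv_X, Pi.single_apply, ofNat_smul_eq_nsmul]

theorem lapB_rb2_mul (f : MvPolynomial (Fin m) ℝ) :
    lapB m (rb2 m * f) = rb2 m * lapB m f + ((2 * m : ℝ) • f + (4 : ℝ) • euler m f) := by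
  have h : lapB m (rb2 m) = (2 * m : ℝ) • 1 := by
    simp only [lapB_apply, pderiv_rb2, Derivation.map_smul, pderiv_X_self, Finset.sum_const,
      Finset.card_univ, Fintype.card_fin]
    module
  rw [lapB_mul, h, euler_apply, smul_mul_assoc, one_mul, Finset.smul_sum,
    add_comm ((2 * m : ℝ) • f), add_assoc]
  congr 2
  refine Finset.sum_congr rfl fun j _ => ?_
  rw [pderiv_rb2, smul_smul, smul_mul_assoc]
  norm_num

end MvPolynomial

/-- The bosonic Laplace system. -/
def bosonicSystem : LaplaceSystem (MvPolynomial (Fin m) ℝ) (Fin m) where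
  Δ := lapB m
  E := MvPolynomial.euler m
  ε := (aeval (fun _ : Fin m => (0 : ℝ))).toLinearMap
  ρ := rb2 m
  c := 2 * m
  u j := (-2 : ℝ) • (pderiv j).toLinearMap
  v j := (pderiv j).toLinearMap
  Δ_mul x y := by
    simp only [MvPolynomial.lapB_mul, LinearMap.smul_apply, Derivation.coeFn_coe]
  E_mul := MvPolynomial.euler_mul m
  ε_mul x y := map_mul (aeval (fun _ : Fin m => (0 : ℝ))) x y
  ε_E x := by simp [MvPolynomial.euler_apply]
  Δ_u j x := by simp [MvPolynomial.lapB_pderiv]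
  Δ_v j x := MvPolynomial.lapB_pderiv m j x
  E_u j x := by
    simp only [LinearMap.smul_apply, Derivation.coeFn_coe, map_smul,
      MvPolynomial.euler_pderiv, smul_sub]
  E_v j x := MvPolynomial.euler_pderiv m j x
  E_ρ := by
    simp only [MvPolynomial.euler_apply, MvPolynomial.pderiv_rb2]
    simp [rb2, Finset.smul_sum, pow_two]
  Δ_ρ_mul := MvPolynomial.lapB_rb2_mul m

variable {m n}

theorem Hb_le_harmonic (p : ℕ) : Hb m p ≤ (bosonicSystem m).harmonic p := by
  rintro f ⟨hf, h0⟩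
  refine (LaplaceSystem.mem_harmonic _).2 ⟨h0, ?_⟩
  rw [show (bosonicSystem m).E = MvPolynomial.euler m from rfl, MvPolynomial.euler_apply,
    ((mem_homogeneousSubmodule _ _).1 hf).sum_X_mul_pderiv, Nat.cast_smul_eq_nsmul]

theorem Hf_le_harmonic (q : ℕ) : Hf n q ≤ (fermionicSystem n).harmonic q := by
  rintro x ⟨hx, h0⟩
  exact (LaplaceSystem.mem_harmonic _).2 ⟨h0, Grass.euler_of_mem_fgrade n hx⟩

namespace LaplaceSystem

variable {A B ι κ : Type*} [Ring A] [Algebra ℝ A] [Ring B] [Algebra ℝ B] [Fintype ι] [Fintype κ]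

theorem tensor_ε_Δ_pow_of_mixed_left (S : LaplaceSystem A ι) (T : LaplaceSystem B κ)
    {z : A ⊗[ℝ] B} (hz : z ∈ Submodule.map₂ (TensorProduct.mk ℝ A B) S.mixed ⊤) (k : ℕ) :
    (S.tensor T).ε (((S.tensor T).Δ ^ k) z) = 0 := by
  refine ε_Δ_pow_eq_zero ?_ ?_ hz k
  · refine Submodule.map₂_le.2 fun a ha b _ => ?_
    simp [tensor, show S.ε a = 0 from S.ε_mixed ha]
  · refine Submodule.map₂_le.2 fun a ha b _ => ?_
    have ha' : S.Δ a ∈ S.mixed := S.Δ_mixed ha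
    exact add_mem (Submodule.apply_mem_map₂ _ ha' Submodule.mem_top)
      (Submodule.apply_mem_map₂ _ ha Submodule.mem_top)

theorem tensor_ε_Δ_pow_of_mixed_right (S : LaplaceSystem A ι) (T : LaplaceSystem B κ)
    {z : A ⊗[ℝ] B} (hz : z ∈ Submodule.map₂ (TensorProduct.mk ℝ A B) ⊤ T.mixed) (k : ℕ) :
    (S.tensor T).ε (((S.tensor T).Δ ^ k) z) = 0 := by
  refine ε_Δ_pow_eq_zero ?_ ?_ hz k
  · refine Submodule.map₂_le.2 fun a _ b hb => ?_
    simp [tensor, show T.ε b = 0 from T.ε_mixed hb]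
  · refine Submodule.map₂_le.2 fun a _ b hb => ?_
    have hb' : T.Δ b ∈ T.mixed := T.Δ_mixed hb
    exact add_mem (Submodule.apply_mem_map₂ _ Submodule.mem_top hb)
      (Submodule.apply_mem_map₂ _ Submodule.mem_top hb')

end LaplaceSystem

/-- The span of the products of powers of the bosonic and the fermionic squared norm. -/
def radial (m n : ℕ) : Submodule ℝ (SuperPoly m n) :=
  Submodule.span ℝ {z | ∃ a b : ℕ, z = (rb2 m ^ a) ⊗ₜ[ℝ] (rf2 n ^ b)}

theorem fkpqC_mem_radial (k p q : ℕ) : fkpqC m n k p q ∈ radial m n := by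
  rw [fkpqC]
  split_ifs
  · exact Submodule.subset_span ⟨0, 0, by simp [Algebra.TensorProduct.one_def]⟩
  · exact Submodule.sum_mem _ fun i _ => Submodule.smul_mem _ _ (Submodule.subset_span ⟨_, _, rfl⟩)

theorem radial_mul_mem {T : Submodule ℝ (SuperPoly m n)} {f f' : MvPolynomial (Fin m) ℝ}
    {x x' : Grass n}
    (hT : ∀ a b, (rb2 m ^ a * (f * f')) ⊗ₜ[ℝ] (rf2 n ^ b * (x * x')) ∈ T)
    {w w' : SuperPoly m n} (hw : w ∈ radial m n) (hw' : w' ∈ radial m n) :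
    (w * (f ⊗ₜ[ℝ] x)) * (w' * (f' ⊗ₜ[ℝ] x')) ∈ T := by
  induction hw using Submodule.span_induction with
  | zero => simp
  | add w₁ w₂ _ _ h₁ h₂ => rw [add_mul, add_mul]; exact T.add_mem h₁ h₂
  | smul c w _ h => rw [smul_mul_assoc, smul_mul_assoc]; exact T.smul_mem _ h
  | mem w hw =>
    obtain ⟨a, b, rfl⟩ := hw
    induction hw' using Submodule.span_induction with
    | zero => simp
    | add w₁ w₂ _ _ h₁ h₂ => rw [add_mul, mul_add]; exact T.add_mem h₁ h₂
    | smul c w _ h => rw [smul_mul_assoc, mul_smul_comm]; exact T.smul_mem _ h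
    | mem w hw =>
      obtain ⟨a', b', rfl⟩ := hw
      have hb : rb2 m ^ a * f * (rb2 m ^ a' * f') = rb2 m ^ (a + a') * (f * f') := by ring
      have hf : rf2 n ^ b * x * (rf2 n ^ b' * x') = rf2 n ^ (b + b') * (x * x') := by
        rw [pow_add, mul_assoc, mul_assoc, ← mul_assoc x,
          ← ((Grass.commute_rf2 n x).pow_left b').eq, mul_assoc]
      simp only [Algebra.TensorProduct.tmul_mul_tmul]
      rw [hb, hf]
      exact hT _ _

theorem fkpq_mul_mem_harmonic (hm : 1 ≤ m) {k p q : ℕ} (hk : k ≤ n - q)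
    {f : MvPolynomial (Fin m) ℝ} (hf : f ∈ Hb m p) {x : Grass n} (hx : x ∈ Hf n q) :
    fkpq m n k p q * (f ⊗ₜ[ℝ] x) ∈
      ((bosonicSystem m).tensor (fermionicSystem n)).harmonic (2 * k + p + q) := by
  obtain ⟨hf0, hfE⟩ := (LaplaceSystem.mem_harmonic _).1 (Hb_le_harmonic p hf)
  obtain ⟨hx0, hxE⟩ := (LaplaceSystem.mem_harmonic _).1 (Hf_le_harmonic q hx)
  have hΔb : ∀ a : ℕ, lapB m (rb2 m ^ a * f) =
      (a * (2 * m + 4 * p + 4 * (a - 1)) : ℝ) • (rb2 m ^ (a - 1) * f) := fun a =>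
    ((bosonicSystem m).Δ_ρ_pow_mul hfE a).trans (by rw [hf0, mul_zero, zero_add]; rfl)
  have hΔf : ∀ b : ℕ, lapF n (rf2 n ^ b * x) =
      (b * (-4 * n + 4 * q + 4 * (b - 1)) : ℝ) • (rf2 n ^ (b - 1) * x) := fun b =>
    ((fermionicSystem n).Δ_ρ_pow_mul hxE b).trans (by rw [hx0, mul_zero, zero_add]; rfl)
  have hEb : ∀ a : ℕ, (bosonicSystem m).E (rb2 m ^ a * f) = (p + 2 * a : ℝ) • (rb2 m ^ a * f) :=
    (bosonicSystem m).E_ρ_pow_mul hfE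
  have hEf : ∀ b : ℕ, (fermionicSystem n).E (rf2 n ^ b * x) =
      (q + 2 * b : ℝ) • (rf2 n ^ b * x) := (fermionicSystem n).E_ρ_pow_mul hxE
  rw [LaplaceSystem.mem_harmonic, fkpq, Finset.sum_mul]
  simp only [smul_mul_assoc, Algebra.TensorProduct.tmul_mul_tmul, map_sum, map_smul]
  constructor
  · simp only [show ((bosonicSystem m).tensor (fermionicSystem n)).Δ = lap m n from rfl, lap,
      LinearMap.add_apply, LinearMap.rTensor_tmul, LinearMap.lTensor_tmul, hΔb, hΔf,
      TensorProduct.tmul_smul, ← TensorProduct.smul_tmul', smul_add, Finset.sum_add_distrib,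
      smul_smul]
    rw [Finset.sum_range_succ, Finset.sum_range_succ' _ k]
    simp only [Nat.sub_self, Nat.cast_zero, zero_mul, mul_zero, zero_smul, add_zero]
    rw [← Finset.sum_add_distrib]
    refine Finset.sum_eq_zero fun i hi => ?_
    have hik : i < k := Finset.mem_range.1 hi
    rw [show k - (i + 1) = k - i - 1 by omega, Nat.add_sub_cancel, ← add_smul]
    convert zero_smul ℝ _
    obtain ⟨g, hg⟩ : ∃ g : ℝ, g = m / 2 + p + k - (i + 1) := ⟨_, rfl⟩
    have hg0 : g ≠ 0 := by
      have h₁ : (1 : ℝ) ≤ m := by exact_mod_cast hm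
      have h₂ : (i + 1 : ℝ) ≤ k := by exact_mod_cast hik
      have h₃ : (0 : ℝ) ≤ p := p.cast_nonneg
      linarith
    have hΓ : Real.Gamma (m / 2 + p + k - i) = g * Real.Gamma g := by
      rw [← Real.Gamma_add_one hg0, hg]
      ring_nf
    have hC : (k.choose (i + 1) : ℝ) * (i + 1) = k.choose i * (k - i) := by
      have h := Nat.choose_succ_right_eq k i
      rw [← @Nat.cast_inj ℝ] at h
      push_cast [Nat.cast_sub hik.le] at h
      exact h
    have hF : ((n - q - i).factorial : ℝ) = (n - q - i) * (n - q - (i + 1)).factorial := by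
      rw [← Nat.mul_factorial_pred (n := n - q - i) (by omega), Nat.cast_mul,
        Nat.cast_sub (by omega), Nat.cast_sub (by omega)]
      rfl
    have hm' : (m : ℝ) = 2 * (g - p - k + (i + 1)) := by linarith
    rw [hΓ, hF, Nat.cast_sub hik.le, Nat.cast_succ, ← hg, hm']
    linear_combination
      (4 * k.choose i * (n - q - i) * (n - q - (i + 1)).factorial * (k - i) / Real.Gamma g) *
        mul_inv_cancel₀ hg0 -
      (4 * (n - q - i) * (n - q - (i + 1)).factorial / Real.Gamma g) * hC
  · simp only [LaplaceSystem.tensor, LinearMap.add_apply, LinearMap.rTensor_tmul,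
      LinearMap.lTensor_tmul, hEb, hEf, TensorProduct.tmul_smul, ← TensorProduct.smul_tmul',
      Finset.smul_sum]
    refine Finset.sum_congr rfl fun i hi => ?_
    rw [Nat.cast_sub (Finset.mem_range_succ_iff.1 hi)]
    module

theorem constTerm_lap_pow_eq_zero (hm : 1 ≤ m) {i p q j r s : ℕ} (hi : i ≤ n - q) (hj : j ≤ n - s)
    (hne : (i, p, q) ≠ (j, r, s)) {f f' : MvPolynomial (Fin m) ℝ} {x x' : Grass n}
    (hf : f ∈ Hb m p) (hx : x ∈ Hf n q) (hf' : f' ∈ Hb m r) (hx' : x' ∈ Hf n s) (k : ℕ) :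
    constTerm m n ((lap m n ^ k)
      ((fkpqC m n i p q * (f ⊗ₜ[ℝ] x)) * (fkpqC m n j r s * (f' ⊗ₜ[ℝ] x')))) = 0 := by
  by_cases hpr : p = r
  · by_cases hqs : q = s
    · subst hpr hqs
      have hij : i ≠ j := by
        rintro rfl
        exact hne rfl
      have hqn : q ≠ n := by omega
      rw [fkpqC, fkpqC, if_neg hqn, if_neg hqn]
      refine LaplaceSystem.ε_Δ_pow_eq_zero (LaplaceSystem.ε_mixed _) (LaplaceSystem.Δ_mixed _)
        (T := ((bosonicSystem m).tensor (fermionicSystem n)).mixed) ?_ k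
      have h := LaplaceSystem.mem_mixed _ 0 ?_ (fkpq_mul_mem_harmonic hm hi hf hx)
        (fkpq_mul_mem_harmonic hm hj hf' hx')
      · rwa [pow_zero, one_mul] at h
      · simpa using hij
    · refine (bosonicSystem m).tensor_ε_Δ_pow_of_mixed_right (fermionicSystem n) ?_ k
      refine radial_mul_mem (fun a b => ?_) (fkpqC_mem_radial i p q) (fkpqC_mem_radial j r s)
      exact Submodule.apply_mem_map₂ _ Submodule.mem_top ((fermionicSystem n).mem_mixed b
        (Nat.cast_injective.ne hqs) (Hf_le_harmonic q hx) (Hf_le_harmonic s hx'))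
  · refine (bosonicSystem m).tensor_ε_Δ_pow_of_mixed_left (fermionicSystem n) ?_ k
    refine radial_mul_mem (fun a b => ?_) (fkpqC_mem_radial i p q) (fkpqC_mem_radial j r s)
    exact Submodule.apply_mem_map₂ _ ((bosonicSystem m).mem_mixed a
      (Nat.cast_injective.ne hpr) (Hb_le_harmonic p hf) (Hb_le_harmonic r hf')) Submodule.mem_top

/-- distinct pieces f_{i,p,q} ℋ^b_p ℋ^f_q and f_{j,r,s} ℋ^b_r ℋ^f_s are
orthogonal with respect to the Pizzetti integral. -/
theorem pizzetti_pieces_orthogonal (m n : ℕ) (hm : 1 ≤ m) (hn : 1 ≤ n)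
    (hM : ∀ j : ℕ, sdim m n ≠ -(2*(j:ℤ)))
    (i p q j r s : ℕ) (hq : q ≤ n) (hs : s ≤ n) (hi : i ≤ n - q) (hj : j ≤ n - s)
    (hne : (i, p, q) ≠ (j, r, s)) :
    ∀ Hbp ∈ Hb m p, ∀ Hfq ∈ Hf n q, ∀ Hbr ∈ Hb m r, ∀ Hfs ∈ Hf n s,
      pizzetti m n
        ((fkpqC m n i p q * (Hbp ⊗ₜ[ℝ] Hfq)) * (fkpqC m n j r s * (Hbr ⊗ₜ[ℝ] Hfs))) = 0 := by
  intro f hf x hx f' hf' x' hx'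
  simp only [pizzetti, constTerm_lap_pow_eq_zero hm hi hj hne hf hx hf' hx', mul_zero, tsum_zero]

end
end
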